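/- arXiv:2102.01654 — 4 statements merged into one kernel-verified Lean document; each statement's English description precedes it below -/
import Mathlib

section
/- For every ℓ > 0, the set of parameter pairs (α, θ) with 0 < α < θ < π/2 and tan θ > 2ℓ + tan α for which the rotation number ρ(F_{ℓ,α,θ}) is irrational has two-dimensional Lebesgue measure zero; equivalently, for Lebesgue-almost every such pair (α, θ), ρ(F_{ℓ,α,θ}) ∈ ℚ. -/
open Real Filter Set

/-- Rotation number of a lift `T` of a circle homeomorphism,
defined as the limit of `T^[n] 0 / n` (which exists and is independent
of the base point for lifts of orientation-preserving circle homeos). -/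
noncomputable def rotationNumber (T : ℝ → ℝ) : ℝ :=
  limUnder atTop (fun n : ℕ => T^[n] 0 / (n : ℝ))

/-- The expansion factor `Λ = sin(θ+α)/sin(θ−α)`. -/
noncomputable def Lam (α θ : ℝ) : ℝ := Real.sin (θ + α) / Real.sin (θ - α)

/-- The break point of increase `a₀ = (tan θ − 2ℓ)/(2 tan θ)`. -/
noncomputable def brk0 (ℓ θ : ℝ) : ℝ := (Real.tan θ - 2 * ℓ) / (2 * Real.tan θ)

/-- The break point of decrease `a₁ = −(2ℓ + tan α)/(2 tan θ)`. -/
noncomputable def brk1 (ℓ α θ : ℝ) : ℝ := -(2 * ℓ + Real.tan α) / (2 * Real.tan θ)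

/-- The two-piece definition of the lift on the fundamental interval `[a₁, a₁+1)`. -/
noncomputable def Ftrap0 (ℓ α θ x : ℝ) : ℝ :=
  if x ≤ brk0 ℓ θ then -brk1 ℓ α θ + (Lam α θ)⁻¹ * (x - brk1 ℓ α θ)
  else 1 - brk0 ℓ θ + Lam α θ * (x - brk0 ℓ θ)

/-- The lift `F_{ℓ,α,θ} : ℝ → ℝ` of the Poincaré map of the internal-wave
billiard in a rectangular trapezoid: it is given by the two-piece formula on
`[a₁, a₁+1)` and extended by `F(x+k) = F(x)+k` for `k ∈ ℤ`. -/
noncomputable def Ftrap (ℓ α θ x : ℝ) : ℝ :=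
  Ftrap0 ℓ α θ (x - ⌊x - brk1 ℓ α θ⌋) + ⌊x - brk1 ℓ α θ⌋

/-- The `2H`-periodic function on `ℤ` equal to `-1` on `[0, H)` and to `1` on `[H, 2H)`. -/
def halfSign (H g : ℤ) : ℤ := if g % (2 * H) < H then -1 else 1

lemma halfSign_congr {H a b : ℤ} (m : ℤ) (h : a = b + m * (2 * H)) :
    halfSign H a = halfSign H b := by
  simp [halfSign, h]

lemma halfSign_low {H g : ℤ} (h0 : 0 ≤ g) (h1 : g < H) : halfSign H g = -1 := by
  rw [halfSign, Int.emod_eq_of_lt h0 (by lia), if_pos h1]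

lemma halfSign_high {H g : ℤ} (h0 : H ≤ g) (h1 : g < 2 * H) : halfSign H g = 1 := by
  rw [halfSign, Int.emod_eq_of_lt (by lia) h1, if_neg (by lia)]

lemma halfSign_add_half {H : ℤ} (hH : 0 < H) (g : ℤ) : halfSign H (g + H) = -halfSign H g := by
  have hg := Int.emod_add_mul_ediv g (2 * H)
  have h0 := Int.emod_nonneg g (b := 2 * H) (by lia)
  have h1 := Int.emod_lt_of_pos g (b := 2 * H) (by lia)
  have e1 : halfSign H g = halfSign H (g % (2 * H)) :=
    halfSign_congr (g / (2 * H)) (by linarith)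
  rcases lt_or_ge (g % (2 * H)) H with h | h
  · rw [e1, halfSign_low h0 h, halfSign_congr (b := g % (2 * H) + H) (g / (2 * H)) (by linarith),
      halfSign_high (by lia) (by lia)]
    rfl
  · rw [e1, halfSign_high h h1,
      halfSign_congr (b := g % (2 * H) - H) (g / (2 * H) + 1) (by linarith),
      halfSign_low (by lia) (by lia)]

lemma halfSign_pred {H g : ℤ} (hH : 0 < H) (hg : ¬ H ∣ g) : halfSign H (g - 1) = halfSign H g := by
  have hd := Int.emod_add_mul_ediv g (2 * H)
  have h0 := Int.emod_nonneg g (b := 2 * H) (by lia)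
  have h1 := Int.emod_lt_of_pos g (b := 2 * H) (by lia)
  have n0 : g % (2 * H) ≠ 0 := fun h => hg ⟨2 * (g / (2 * H)), by rw [h] at hd; linarith⟩
  have n1 : g % (2 * H) ≠ H := fun h => hg ⟨2 * (g / (2 * H)) + 1, by rw [h] at hd; linarith⟩
  rw [halfSign_congr (a := g) (b := g % (2 * H)) (g / (2 * H)) (by linarith),
    halfSign_congr (b := g % (2 * H) - 1) (g / (2 * H)) (by linarith)]
  rcases lt_or_ge (g % (2 * H)) H with h | h
  · rw [halfSign_low h0 h, halfSign_low (by lia) (by lia)]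
  · rw [halfSign_high h h1, halfSign_high (by lia) (by lia)]

/-- Every function on `ℤ` with values in an abelian group has a discrete primitive. -/
lemma exists_discrete_primitive {M : Type*} [AddCommGroup M] (d : ℤ → M) :
    ∃ X : ℤ → M, X 0 = 0 ∧ ∀ g, X (g + 1) = X g + d g := by
  refine ⟨fun n => ∑ i ∈ Finset.range n.toNat, d i -
    ∑ i ∈ Finset.range (-n).toNat, d (-((i : ℤ) + 1)), by simp, fun g => ?_⟩
  rcases le_or_gt 0 g with hg | hg
  · obtain ⟨n, rfl⟩ := Int.eq_ofNat_of_zero_le hg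
    have e1 : ((n : ℤ) + 1).toNat = n + 1 := by lia
    have e2 : (-((n : ℤ) + 1)).toNat = 0 := by lia
    have e3 : (-(n : ℤ)).toNat = 0 := by lia
    simp only [e1, e2, e3, Int.toNat_natCast, Finset.sum_range_succ, Finset.range_zero,
      Finset.sum_empty]
    abel
  · obtain ⟨n, hn⟩ := Int.eq_ofNat_of_zero_le (show 0 ≤ -g - 1 by lia)
    obtain rfl : g = -((n : ℤ) + 1) := by lia
    have e1 : (-((n : ℤ) + 1) + 1).toNat = 0 := by lia
    have e2 : (-(-((n : ℤ) + 1) + 1)).toNat = n := by lia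
    have e3 : (-((n : ℤ) + 1)).toNat = 0 := by lia
    have e4 : (-(-((n : ℤ) + 1))).toNat = n + 1 := by lia
    simp only [e1, e2, e3, e4, Finset.sum_range_succ, Finset.range_zero, Finset.sum_empty]
    abel

/-- The exponents of the gap lengths of a rigid orbit of type `P / (2H)`: a single `2H`-periodic
function whose increments along both the step `1` and the step `P` are given by `halfSign`. -/
lemma exists_exponents {H q P p : ℤ} (hH : 0 < H) (hq : Odd q)
    (hqP : q * P = p * (2 * H) + 1) :
    ∃ w : ℤ → ℤ, (∀ g, w (g + 1) = w g + halfSign H ((g + 1) * q - 1)) ∧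
      (∀ g, w (g + P) = w g + halfSign H g) ∧ ∀ g, w (g + 2 * H) = w g := by
  obtain ⟨w, -, hw⟩ := exists_discrete_primitive (fun g : ℤ => halfSign H ((g + 1) * q - 1))
  obtain ⟨j, hj⟩ := hq
  have const_of {D : ℤ → ℤ} (hD : ∀ g, D (g + 1) = D g) (g : ℤ) : D g = D 0 := by
    induction g using Int.induction_on with
    | zero => rfl
    | succ i ih => rw [hD, ih]
    | pred i ih => rw [← ih, ← hD]; congr 1; ring
  have hanti : ∀ g, w (g + H) + w g = w (0 + H) + w 0 := by
    refine const_of (D := fun g => w (g + H) + w g) fun g => ?_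
    have e : halfSign H ((g + H + 1) * q - 1) = -halfSign H ((g + 1) * q - 1) := by
      rw [← halfSign_add_half hH]
      exact halfSign_congr j (by rw [hj]; ring)
    have := hw (g + H)
    rw [show g + 1 + H = g + H + 1 by ring, this, hw, e]
    ring
  have hper : ∀ g, w (g + 2 * H) = w g := fun g => by
    have h1 := hanti g
    have h2 := hanti (g + H)
    rw [show g + H + H = g + 2 * H by ring] at h2
    lia
  have hD : ∀ g, w (g + H + P) - w (g + H) = -(w (g + P) - w g) := fun g => by
    have h1 := hanti g
    have h2 := hanti (g + P)
    rw [show g + P + H = g + H + P by ring] at h2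
    lia
  have hstep : ∀ g, w (g + 1 + P) - w (g + 1) = w (g + P) - w g +
      (halfSign H ((g + 1) * q) - halfSign H ((g + 1) * q - 1)) := fun g => by
    have h1 := hw (g + P)
    have h2 := hw g
    have e : halfSign H ((g + P + 1) * q - 1) = halfSign H ((g + 1) * q) :=
      halfSign_congr p (by linear_combination hqP)
    rw [show g + 1 + P = g + P + 1 by ring, h1, h2, e]
    ring
  have hcop : ∀ g, H ∣ g * q → H ∣ g := fun g ⟨c, hc⟩ =>
    ⟨c * P - 2 * p * g, by linear_combination P * hc - g * hqP⟩
  have hlow : ∀ n : ℕ, (n : ℤ) < H → w (n + P) - w n = w (0 + P) - w 0 := by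
    intro n
    induction n with
    | zero => simp
    | succ n ih =>
      intro hn
      push_cast at hn ⊢
      rw [hstep, ih (by lia), halfSign_pred hH, sub_self, add_zero]
      intro h
      have := Int.le_of_dvd (by lia) (hcop _ h)
      lia
  have hH0 : w (0 + P) - w 0 = -1 := by
    obtain ⟨n, hn⟩ := Int.eq_ofNat_of_zero_le (show 0 ≤ H - 1 by lia)
    have h1 := hstep n
    rw [hlow n (by lia)] at h1
    have e : (n : ℤ) + 1 = 0 + H := by lia
    rw [e, hD 0, halfSign_congr (a := (0 + H) * q) (b := H) j (by rw [hj]; ring),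
      halfSign_congr (a := (0 + H) * q - 1) (b := H - 1) j (by rw [hj]; ring),
      halfSign_high le_rfl (by lia), halfSign_low (by lia) (by lia)] at h1
    lia
  have hbase : ∀ g, 0 ≤ g → g < H → w (g + P) - w g = -1 := fun g h0 h1 => by
    obtain ⟨n, rfl⟩ := Int.eq_ofNat_of_zero_le h0
    rw [hlow n h1, hH0]
  refine ⟨w, hw, fun g => ?_, hper⟩
  have hper' : ∀ m g : ℤ, w (g + m * (2 * H)) = w g := fun m g => by
    have := const_of (D := fun m => w (g + m * (2 * H))) (fun m => by
      rw [show g + (m + 1) * (2 * H) = g + m * (2 * H) + 2 * H by ring, hper]) m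
    simpa using this
  have hd := Int.emod_add_mul_ediv g (2 * H)
  have h0 := Int.emod_nonneg g (b := 2 * H) (by lia)
  have h1 := Int.emod_lt_of_pos g (b := 2 * H) (by lia)
  set g' := g % (2 * H)
  have hg : g = g' + g / (2 * H) * (2 * H) := by linarith
  rw [hg, halfSign_congr _ rfl, hper', show ∀ m : ℤ, g' + m * (2 * H) + P = g' + P + m * (2 * H) by
    intro m; ring, hper']
  rcases lt_or_ge g' H with h | h
  · rw [halfSign_low h0 h]
    linarith [hbase g' h0 h]
  · rw [halfSign_high h h1]
    have h2 := hD (g' - H)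
    rw [hbase (g' - H) (by lia) (by lia)] at h2
    rw [sub_add_cancel] at h2
    linarith

/-- The lift of the circle homeomorphism with slope `lam⁻¹` on `[0, lam / (1 + lam)]`, slope `lam`
on `[lam / (1 + lam), 1]`, and fixing `0`. -/
noncomputable def baseMap (lam y : ℝ) : ℝ :=
  ⌊y⌋ + max (Int.fract y / lam) (1 - lam * (1 - Int.fract y))

lemma break_lt_one {lam : ℝ} (hl : 1 < lam) : lam / (1 + lam) < 1 := by
  rw [div_lt_one (by linarith)]; linarith

lemma baseMap_low {lam : ℝ} (hl : 1 < lam) (m : ℤ) {y : ℝ} (h0 : m ≤ y)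
    (h1 : y ≤ m + lam / (1 + lam)) : baseMap lam y = m + (y - m) / lam := by
  have hL := break_lt_one hl
  have hm : ⌊y⌋ = m := Int.floor_eq_iff.2 ⟨h0, by linarith⟩
  rw [baseMap, Int.fract, hm, max_eq_left]
  have h2 : (y - m) * (1 + lam) ≤ lam := by
    rw [← le_div_iff₀ (by linarith)]; linarith
  rw [le_div_iff₀ (by linarith)]
  nlinarith

lemma baseMap_high {lam : ℝ} (hl : 1 < lam) (m : ℤ) {y : ℝ} (h0 : m + lam / (1 + lam) ≤ y)
    (h1 : y ≤ m + 1) : baseMap lam y = m + 1 - lam * (m + 1 - y) := by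
  have hL : 0 < lam / (1 + lam) := by positivity
  rcases h1.eq_or_lt with rfl | h1
  · have : ((m : ℝ) + 1) = ((m + 1 : ℤ) : ℝ) := by push_cast; rfl
    rw [this, baseMap, Int.fract_intCast, Int.floor_intCast, max_eq_left (by simp; linarith)]
    simp
  have hm : ⌊y⌋ = m := Int.floor_eq_iff.2 ⟨by linarith, h1⟩
  rw [baseMap, Int.fract, hm, max_eq_right]
  · ring
  have h2 : lam ≤ (y - m) * (1 + lam) := by
    rw [← div_le_iff₀ (by linarith)]; linarith
  rw [div_le_iff₀ (by linarith)]
  nlinarith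

lemma baseMap_monotone {lam : ℝ} (hl : 1 < lam) : Monotone (baseMap lam) := by
  have hl0 : 0 < lam := by linarith
  intro x y hxy
  rcases (Int.floor_mono hxy).eq_or_lt with h | h
  · have hf : Int.fract x ≤ Int.fract y := by simp only [Int.fract, h]; linarith
    unfold baseMap
    rw [h]
    gcongr
  · have h' : (⌊x⌋ : ℝ) + 1 ≤ ⌊y⌋ := by exact_mod_cast h
    have h1 : max (Int.fract x / lam) (1 - lam * (1 - Int.fract x)) ≤ 1 := by
      have := Int.fract_lt_one x
      refine max_le ((div_le_one hl0).2 (by linarith)) ?_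
      nlinarith
    have h2 : 0 ≤ max (Int.fract y / lam) (1 - lam * (1 - Int.fract y)) :=
      le_max_of_le_left (div_nonneg (Int.fract_nonneg y) hl0.le)
    unfold baseMap
    linarith

/-- The family of translates of `baseMap`. -/
noncomputable def trapLift {lam : ℝ} (hl : 1 < lam) (t : ℝ) : CircleDeg1Lift where
  toFun y := t + baseMap lam y
  monotone' _ _ h := add_le_add_right (baseMap_monotone hl h) t
  map_add_one' y := by simp [baseMap]; ring

lemma trapLift_apply {lam : ℝ} (hl : 1 < lam) (t y : ℝ) :
    trapLift hl t y = t + baseMap lam y := rfl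

/-- A bi-infinite sequence of points, invariant under the translate of `baseMap` that moves the
origin to `X P`; here `ℓ g` is the length of the gap between `X g` and `X (g + 1)`. -/
structure IsRigidOrbit (lam : ℝ) (H q P : ℤ) (X ℓ : ℤ → ℝ) : Prop where
  zero : X 0 = 0
  step : ∀ g, X (g + 1) = X g + ℓ g
  period : ∀ g, X (g + 2 * H) = X g + 1
  pos : ∀ g, 0 < ℓ g
  ratio_one : ∀ g, ℓ (g + 1) = ℓ g * lam ^ halfSign H ((g + 1) * q - 1)
  ratio_P : ∀ g, ℓ (g + P) = ℓ g * lam ^ halfSign H g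

lemma exists_isRigidOrbit {lam : ℝ} (hl : 0 < lam) {H q P p : ℤ} (hH : 0 < H) (hq : Odd q)
    (hqP : q * P = p * (2 * H) + 1) : ∃ X ℓ, IsRigidOrbit lam H q P X ℓ := by
  obtain ⟨w, hw1, hwP, hwH⟩ := exists_exponents hH hq hqP
  obtain ⟨Y, hY0, hY⟩ := exists_discrete_primitive (fun g => lam ^ w g)
  have hYmono : StrictMono Y := strictMono_int_of_lt_succ fun g => by
    rw [hY]; linarith [zpow_pos hl (w g)]
  set Z := Y (2 * H) with hZ
  have hZpos : 0 < Z := by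
    rw [← hY0]; exact hYmono (by lia)
  have hYper : ∀ g, Y (g + 2 * H) = Y g + Z := fun g => by
    induction g using Int.induction_on with
    | zero => simp [hY0, hZ]
    | succ i ih =>
      rw [show (i : ℤ) + 1 + 2 * H = i + 2 * H + 1 by ring, hY, hY, ih, hwH]; ring
    | pred i ih =>
      have h1 := hY (-(i : ℤ) - 1)
      have h2 := hY (-(i : ℤ) - 1 + 2 * H)
      rw [sub_add_cancel] at h1
      rw [show -(i : ℤ) - 1 + 2 * H + 1 = -i + 2 * H by ring, ih, hwH] at h2
      linarith
  refine ⟨fun g => Y g / Z, fun g => lam ^ w g / Z, by simp [hY0], fun g => ?_, fun g => ?_,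
    fun g => by positivity, fun g => ?_, fun g => ?_⟩
  · simp only [hY]; ring
  · simp only [hYper]; field_simp
  · simp only [hw1, zpow_add₀ hl.ne']; ring
  · simp only [hwP, zpow_add₀ hl.ne']; ring

namespace IsRigidOrbit

variable {lam : ℝ} {H q P p : ℤ} {X ℓ : ℤ → ℝ}

lemma strictMono (hX : IsRigidOrbit lam H q P X ℓ) : StrictMono X :=
  strictMono_int_of_lt_succ fun g => by rw [hX.step]; linarith [hX.pos g]

lemma period_mul (hX : IsRigidOrbit lam H q P X ℓ) (m g : ℤ) :
    X (g + m * (2 * H)) = X g + m := by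
  induction m using Int.induction_on with
  | zero => simp
  | succ i ih =>
    rw [show g + ((i : ℤ) + 1) * (2 * H) = g + i * (2 * H) + 2 * H by ring, hX.period, ih]
    push_cast; ring
  | pred i ih =>
    have := hX.period (g + (-(i : ℤ) - 1) * (2 * H))
    rw [show g + (-(i : ℤ) - 1) * (2 * H) + 2 * H = g + -(i : ℤ) * (2 * H) by ring, ih] at this
    push_cast at this ⊢; linarith

lemma gap_period_mul (hX : IsRigidOrbit lam H q P X ℓ) (m g : ℤ) :
    ℓ (g + m * (2 * H)) = ℓ g := by
  have h1 := hX.step (g + m * (2 * H))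
  rw [show g + m * (2 * H) + 1 = g + 1 + m * (2 * H) by ring, hX.period_mul, hX.period_mul,
    hX.step] at h1
  linarith

lemma gap_lt_one (hX : IsRigidOrbit lam H q P X ℓ) (hH : 0 < H) (g : ℤ) : ℓ g < 1 := by
  have h1 := hX.strictMono (show g + 1 < g + 2 * H by lia)
  rw [hX.step, hX.period] at h1
  linarith

lemma low (hX : IsRigidOrbit lam H q P X ℓ) (n : ℕ) (hn : (n : ℤ) ≤ H) :
    X (n + P) = X P + X n / lam := by
  induction n with
  | zero => simp [hX.zero]
  | succ n ih =>
    push_cast at hn ⊢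
    rw [show (n : ℤ) + 1 + P = n + P + 1 by ring, hX.step, ih (by lia), hX.ratio_P, hX.step,
      halfSign_low (by lia) (by lia)]
    rw [zpow_neg_one]; ring

lemma high (hX : IsRigidOrbit lam H q P X ℓ) (n : ℕ) (hn : (n : ℤ) ≤ H) :
    X (H + n + P) = X (H + P) + lam * (X (H + n) - X H) := by
  induction n with
  | zero => simp
  | succ n ih =>
    push_cast at hn ⊢
    rw [show H + ((n : ℤ) + 1) + P = H + n + P + 1 by ring, hX.step, ih (by lia), hX.ratio_P,
      ← add_assoc H, hX.step, halfSign_high (by lia) (by lia), zpow_one]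
    ring

lemma break_eq (hX : IsRigidOrbit lam H q P X ℓ) (hl : 1 < lam) (hH : 0 < H) :
    X H = lam / (1 + lam) := by
  obtain ⟨n, hn⟩ := Int.eq_ofNat_of_zero_le hH.le
  have h1 := hX.low n (by lia)
  have h2 := hX.high n (by lia)
  rw [show H + (n : ℤ) + P = P + 2 * H by lia, show H + (n : ℤ) = 0 + 2 * H by lia, hX.period,
    hX.period, hX.zero, hn, h1] at h2
  have h3 : (1 + lam) * (lam - 1) * X n = lam * (lam - 1) := by
    field_simp at h2; linarith
  rw [hn, eq_div_iff (by linarith)]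
  have h4 : lam - 1 ≠ 0 := by linarith
  apply mul_left_cancel₀ h4
  linarith

/-- The action of the family on the closed gap to the right of `X g`. -/
lemma apply_gap (hX : IsRigidOrbit lam H q P X ℓ) (hl : 1 < lam) (hH : 0 < H) (s : ℝ) (g : ℤ)
    {y : ℝ} (h0 : X g ≤ y) (h1 : y ≤ X (g + 1)) :
    trapLift hl s y = s - X P + X (g + P) + lam ^ halfSign H g * (y - X g) := by
  obtain ⟨m, n, hg1, rfl⟩ : ∃ (m : ℤ) (n : ℕ), (n : ℤ) < 2 * H ∧ g = n + m * (2 * H) := by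
    obtain ⟨n, hn⟩ := Int.eq_ofNat_of_zero_le (Int.emod_nonneg g (b := 2 * H) (by lia))
    refine ⟨g / (2 * H), n, hn ▸ Int.emod_lt_of_pos g (by lia), ?_⟩
    linarith [Int.emod_add_mul_ediv g (2 * H)]
  have hL := hX.break_eq hl hH
  have hmono := hX.strictMono.monotone
  rw [show (n : ℤ) + m * (2 * H) + 1 = n + 1 + m * (2 * H) by ring] at h1
  rw [show (n : ℤ) + m * (2 * H) + P = n + P + m * (2 * H) by ring, halfSign_congr m rfl,
    trapLift_apply]
  rw [hX.period_mul] at h0 h1 ⊢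
  rw [hX.period_mul]
  rcases lt_or_ge (n : ℤ) H with h | h
  · have a0 := hmono (show (0 : ℤ) ≤ n by lia)
    have a1 := hmono (show (n : ℤ) + 1 ≤ H by lia)
    rw [hX.zero] at a0
    rw [hL] at a1
    rw [baseMap_low hl m (by linarith) (by linarith), halfSign_low (by lia) h, hX.low n h.le,
      zpow_neg_one]
    field_simp
    ring
  · obtain ⟨k, hk⟩ := Int.eq_ofNat_of_zero_le (show 0 ≤ (n : ℤ) - H by lia)
    have a0 := hmono h
    have a1 := hmono (show (n : ℤ) + 1 ≤ 0 + 2 * H by lia)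
    rw [hL] at a0
    rw [hX.period, hX.zero] at a1
    rw [baseMap_high hl m (by linarith) (by linarith), halfSign_high h hg1, zpow_one,
      show (n : ℤ) = H + k by lia, hX.high k (by lia)]
    obtain ⟨j, hj⟩ := Int.eq_ofNat_of_zero_le hH.le
    have a2 := hX.low j (by lia)
    rw [← hj] at a2
    rw [a2, hL]
    field_simp
    ring

end IsRigidOrbit

namespace IsRigidOrbit

variable {lam : ℝ} {H P p : ℤ} {q : ℕ} {X ℓ : ℤ → ℝ}

/-- The sum of the inverse gap lengths along the first `k` steps of the orbit of `X h`. -/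
noncomputable def weight (ℓ : ℤ → ℝ) (P h : ℤ) (k : ℕ) : ℝ :=
  ∑ i ∈ Finset.range k, (ℓ (h + ((i : ℤ) + 1) * P))⁻¹

lemma weight_succ (ℓ : ℤ → ℝ) (P h : ℤ) (k : ℕ) :
    weight ℓ P h (k + 1) = weight ℓ P h k + (ℓ (h + ((k : ℤ) + 1) * P))⁻¹ :=
  Finset.sum_range_succ _ _

lemma weight_mono (hX : IsRigidOrbit lam H q P X ℓ) (h : ℤ) : Monotone (weight ℓ P h) :=
  monotone_nat_of_le_succ fun k => by
    rw [weight_succ]; linarith [inv_pos.2 (hX.pos (h + ((k : ℤ) + 1) * P))]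

lemma halfSign_orbit (hH : 0 < H) (hq : Odd q) (hqP : q * P = p * (2 * H) + 1) {h : ℤ}
    (hh : H ∣ h) (k : ℕ) (hk : (k : ℤ) < H) :
    halfSign H ((h + ((k : ℤ) + 1) * P) * q - 1) = halfSign H h := by
  obtain ⟨c, rfl⟩ := hh
  obtain ⟨j, rfl⟩ := hq
  rw [halfSign_congr (b := H * c + k) (j * c + (k + 1) * p)
    (by push_cast at hqP ⊢; linear_combination ((k : ℤ) + 1) * hqP)]
  induction k with
  | zero => simp
  | succ k ih =>
    push_cast at hk ⊢
    rw [← ih (by lia), ← halfSign_pred hH]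
    · congr 1; ring
    · rw [Int.dvd_add_right (dvd_mul_right H c)]
      intro h
      have := Int.le_of_dvd (by lia) h
      lia

lemma not_dvd_orbit (hqP : q * P = p * (2 * H) + 1) (hqH : (q : ℤ) ≤ H) {h : ℤ}
    (hh : H ∣ h) {k : ℕ} (hk0 : k ≠ 0) (hk : k < q) : ¬ H ∣ h + k * P := by
  intro hd
  rw [Int.dvd_add_right hh] at hd
  obtain ⟨c, hc⟩ := hd
  have : H ∣ k := ⟨c * q - k * p * 2, by linear_combination (q : ℤ) * hc - k * hqP⟩
  have := Int.le_of_dvd (by lia) this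
  lia

lemma iterate_eq (hX : IsRigidOrbit lam H q P X ℓ) (hl : 1 < lam) (hH : 0 < H) (hq : Odd q)
    (hqP : q * P = p * (2 * H) + 1) (hqH : (q : ℤ) ≤ H) {h : ℤ} (hh : H ∣ h) {s : ℝ}
    (h0 : -lam ^ (-halfSign H h) ≤ (s - X P) * weight ℓ P h q)
    (h1 : (s - X P) * weight ℓ P h q ≤ 1) (k : ℕ) (hk : k ≤ q) :
    (trapLift hl s)^[k] (X h) =
      X (h + k * P) + (s - X P) * ℓ (h + k * P) * weight ℓ P h k := by
  induction k with
  | zero => simp [weight]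
  | succ k ih =>
    have hl0 : 0 < lam := by linarith
    have hw0 : 0 ≤ weight ℓ P h k := by
      simpa [weight] using hX.weight_mono h (Nat.zero_le k)
    have hwk := hX.weight_mono h (show k ≤ q by lia)
    rw [Function.iterate_succ_apply', ih (by lia), weight_succ]
    set g : ℤ := h + k * P with hg
    have e1 : h + ((k : ℤ) + 1) * P = g + P := by rw [hg]; ring
    have e2 : h + ((k + 1 : ℕ) : ℤ) * P = g + P := by push_cast; exact e1
    rw [e1, e2]
    have hpos := hX.pos g
    have hpos' := hX.pos (g + P)
    have key : trapLift hl s (X g + (s - X P) * ℓ g * weight ℓ P h k) = s - X P + X (g + P) +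
        lam ^ halfSign H g * ((s - X P) * ℓ g * weight ℓ P h k) := by
      by_cases hc : 0 ≤ s - X P ∨ k = 0
      · have hy : 0 ≤ (s - X P) * weight ℓ P h k ∧ (s - X P) * weight ℓ P h k ≤ 1 := by
          rcases hc with hc | rfl
          · exact ⟨mul_nonneg hc hw0, (mul_le_mul_of_nonneg_left hwk hc).trans h1⟩
          · simp [weight]
        rw [hX.apply_gap hl hH s g]
        · ring
        · nlinarith
        · rw [hX.step]; nlinarith
      · push Not at hc
        have hy0 : (s - X P) * weight ℓ P h k ≤ 0 := mul_nonpos_of_nonpos_of_nonneg hc.1.le hw0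
        have hy1 := h0.trans (mul_le_mul_of_nonpos_left hwk hc.1.le)
        have hs := hX.step (g - 1)
        rw [sub_add_cancel] at hs
        have hr := hX.ratio_one (g - 1)
        obtain ⟨j, rfl⟩ := Nat.exists_eq_succ_of_ne_zero hc.2
        have hsign : halfSign H (g * q - 1) = halfSign H h := by
          rw [← halfSign_orbit hH hq hqP hh j (by lia), hg]; push_cast; rfl
        rw [sub_add_cancel, hsign] at hr
        have hp := halfSign_pred hH (not_dvd_orbit hqP hqH hh hc.2 (by lia))
        rw [← hg] at hp
        have hrP := hX.ratio_P (g - 1)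
        have hsP := hX.step (g - 1 + P)
        rw [show g - 1 + P + 1 = g + P by ring] at hsP
        have hpos1 := hX.pos (g - 1)
        rw [hX.apply_gap hl hH s (g - 1), hp, hsP, hrP, hp, hs]
        · ring
        · have hr' : ℓ g * lam ^ (-halfSign H h) = ℓ (g - 1) := by
            rw [hr, zpow_neg]; field_simp
          rw [hs, ← hr']; nlinarith
        · rw [sub_add_cancel]; nlinarith
    rw [key, hX.ratio_P g]
    have : lam ^ halfSign H g ≠ 0 := (zpow_pos hl0 _).ne'
    field_simp
    ring

end IsRigidOrbit

lemma translationNumber_le_div {f : CircleDeg1Lift} {x : ℝ} {p : ℤ} {q : ℕ} (hq : 0 < q)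
    (h : f^[q] x ≤ x + p) : f.translationNumber ≤ p / q := by
  rw [le_div_iff₀ (by positivity), mul_comm, ← CircleDeg1Lift.translationNumber_pow]
  exact (f ^ q).translationNumber_le_of_le_add_int (x := x) (by rwa [CircleDeg1Lift.coe_pow])

lemma div_le_translationNumber {f : CircleDeg1Lift} {x : ℝ} {p : ℤ} {q : ℕ} (hq : 0 < q)
    (h : x + p ≤ f^[q] x) : p / q ≤ f.translationNumber := by
  rw [div_le_iff₀ (by positivity), mul_comm, ← CircleDeg1Lift.translationNumber_pow]
  exact (f ^ q).le_translationNumber_of_add_int_le (x := x) (by rwa [CircleDeg1Lift.coe_pow])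

lemma trapLift_mono {lam : ℝ} (hl : 1 < lam) : Monotone (trapLift hl) :=
  fun s t hst y => by simp only [trapLift_apply]; linarith

namespace IsRigidOrbit

variable {lam : ℝ} {H P p : ℤ} {q : ℕ} {X ℓ : ℤ → ℝ}

lemma gap_add_mul (hX : IsRigidOrbit lam H q P X ℓ) (hqP : q * P = p * (2 * H) + 1) (i : ℤ) :
    ℓ ((i + q) * P) = ℓ (i * P) * lam ^ halfSign H (i + q - 1) := by
  rw [show (i + q) * P = i * P + 1 + p * (2 * H) by linear_combination hqP, hX.gap_period_mul,
    hX.ratio_one]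
  congr 2
  exact halfSign_congr (i * p) (by linear_combination i * hqP)

lemma weight_le_mul_weight (hX : IsRigidOrbit lam H q P X ℓ) (hl : 1 < lam)
    (hqP : q * P = p * (2 * H) + 1) (hqH : (q : ℤ) ≤ H) (hP : Odd P) :
    weight ℓ P 0 q ≤ lam * weight ℓ P H q := by
  have hmono : ∀ m : ℕ, (m : ℤ) + q ≤ H → weight ℓ P 0 q ≤ weight ℓ P (m * P) q := by
    intro m
    induction m with
    | zero => simp
    | succ m ih =>
      intro hm
      push_cast at hm ⊢
      refine (ih (by lia)).trans ?_
      have e1 := weight_succ ℓ P (m * P) q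
      rw [weight, Finset.sum_range_succ'] at e1
      have e2 : ∑ i ∈ Finset.range q, (ℓ (m * P + (((i + 1 : ℕ) : ℤ) + 1) * P))⁻¹ =
          weight ℓ P (((m : ℤ) + 1) * P) q :=
        Finset.sum_congr rfl fun i _ => by congr 2; push_cast; ring
      have e3 := hX.gap_add_mul hqP (m + 1)
      rw [halfSign_low (by lia) (by lia), zpow_neg_one] at e3
      rw [e2, show m * P + ((q : ℤ) + 1) * P = (m + 1 + q) * P by ring,
        show m * P + (((0 : ℕ) : ℤ) + 1) * P = (m + 1) * P by push_cast; ring, e3, mul_inv,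
        inv_inv] at e1
      have := inv_pos.2 (hX.pos ((m + 1) * P))
      nlinarith
  obtain ⟨m, hm⟩ := Int.eq_ofNat_of_zero_le (show 0 ≤ H - q by lia)
  refine (hmono m (by lia)).trans_eq ?_
  obtain ⟨j, hj⟩ := hP
  rw [weight, weight, Finset.mul_sum]
  refine Finset.sum_congr rfl fun i hi => ?_
  have hi := Finset.mem_range.1 hi
  have hg := hX.gap_add_mul hqP (m + 1 + i)
  rw [halfSign_high (by lia) (by lia), zpow_one] at hg
  have e : H + ((i : ℤ) + 1) * P = (m + 1 + i + q) * P + (-j) * (2 * H) := by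
    rw [show (m : ℤ) = H - q by lia, hj]; ring
  rw [e, hX.gap_period_mul, hg, show m * P + ((i : ℤ) + 1) * P = (m + 1 + i) * P by ring]
  have := hX.pos ((m + 1 + i) * P)
  field_simp

lemma le_weight (hX : IsRigidOrbit lam H q P X ℓ) (hH : 0 < H) (h : ℤ) (k : ℕ) :
    (k : ℝ) ≤ weight ℓ P h k := by
  induction k with
  | zero => simp [weight]
  | succ k ih =>
    rw [weight_succ]
    push_cast
    have := one_le_inv_iff₀.2 ⟨hX.pos (h + ((k : ℤ) + 1) * P),
      (hX.gap_lt_one hH (h + ((k : ℤ) + 1) * P)).le⟩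
    linarith

lemma iterate_lower (hX : IsRigidOrbit lam H q P X ℓ) (hl : 1 < lam) (hH : 0 < H) (hq : Odd q)
    (hqP : q * P = p * (2 * H) + 1) (hqH : (q : ℤ) ≤ H) {h : ℤ} (hh : H ∣ h) :
    (trapLift hl (X P - lam ^ (-halfSign H h) / weight ℓ P h q))^[q] (X h) = X h + p := by
  have hl0 : 0 < lam := by linarith
  have hq0 := hq.pos
  have hW : 0 < weight ℓ P h q := lt_of_lt_of_le (by positivity) (hX.le_weight hH h q)
  have hz := zpow_pos hl0 (-halfSign H h)
  have e : (X P - lam ^ (-halfSign H h) / weight ℓ P h q - X P) * weight ℓ P h q =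
      -lam ^ (-halfSign H h) := by field_simp; ring
  rw [hX.iterate_eq hl hH hq hqP hqH hh e.ge (by linarith) q le_rfl, mul_right_comm, e]
  have hr := hX.ratio_one (h + q * P - 1)
  have hs := hX.step (h + q * P - 1)
  have hsign := halfSign_orbit hH hq hqP hh (q - 1) (by lia)
  rw [Nat.cast_pred hq0, sub_add_cancel] at hsign
  rw [sub_add_cancel, hsign] at hr
  rw [sub_add_cancel, show h + q * P - 1 = h + p * (2 * H) by linear_combination hqP,
    hX.period_mul] at hs
  rw [hs, hr, show h + q * P - 1 = h + p * (2 * H) by linear_combination hqP, zpow_neg]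
  field_simp
  ring

lemma iterate_upper (hX : IsRigidOrbit lam H q P X ℓ) (hl : 1 < lam) (hH : 0 < H) (hq : Odd q)
    (hqP : q * P = p * (2 * H) + 1) (hqH : (q : ℤ) ≤ H) :
    (trapLift hl (X P + 1 / weight ℓ P 0 q))^[q] 0 = X 2 + p := by
  have hl0 : 0 < lam := by linarith
  have hq0 := hq.pos
  have hW : 0 < weight ℓ P 0 q := lt_of_lt_of_le (by positivity) (hX.le_weight hH 0 q)
  have hz := zpow_pos hl0 (-halfSign H 0)
  have e : (X P + 1 / weight ℓ P 0 q - X P) * weight ℓ P 0 q = 1 := by field_simp; ring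
  have := hX.iterate_eq hl hH hq hqP hqH (dvd_zero H) (by linarith) e.le q le_rfl
  rw [hX.zero] at this
  rw [this, mul_right_comm, e, one_mul, ← hX.step, show 0 + q * P + 1 = 2 + p * (2 * H) by
    linear_combination hqP, hX.period_mul]

lemma iterate_rigid (hX : IsRigidOrbit lam H q P X ℓ) (hl : 1 < lam) (hH : 0 < H) (g : ℤ)
    (k : ℕ) : (trapLift hl (X P))^[k] (X g) = X (g + k * P) := by
  induction k with
  | zero => simp
  | succ k ih =>
    rw [Function.iterate_succ_apply', ih, hX.apply_gap hl hH _ _ le_rfl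
      (hX.strictMono.monotone (by lia))]
    push_cast
    rw [show g + k * P + P = g + (k + 1) * P by ring]
    ring

end IsRigidOrbit

/-- Between two Farey neighbours with odd denominators, the parameters are located next to a long
interval on which the translation number is the left neighbour. -/
theorem exists_hole {lam : ℝ} (hl : 1 < lam) {p p' : ℤ} {q q' : ℕ} (hq : Odd q) (hq' : Odd q')
    (hqq : q ≤ q') (hdet : p' * q - p * q' = 1) :
    ∃ r W : ℝ, q ≤ W ∧
      (∀ s ∈ Icc (r - lam / W) (r - 1 / W), (trapLift hl s).translationNumber = p / q) ∧
      ∀ t, p / q < (trapLift hl t).translationNumber →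
        (trapLift hl t).translationNumber < p' / q' → |t - r| ≤ 1 / W := by
  have hq0 := hq.pos
  obtain ⟨H, hH⟩ : ∃ H : ℤ, q + q' = 2 * H := by
    obtain ⟨i, rfl⟩ := hq
    obtain ⟨j, rfl⟩ := hq'
    exact ⟨i + j + 1, by push_cast; ring⟩
  have hH0 : 0 < H := by lia
  have hqH : (q : ℤ) ≤ H := by lia
  have hqP : q * (p + p') = p * (2 * H) + 1 := by rw [← hH]; linear_combination hdet
  have hP : Odd (p + p') := by
    by_contra hP
    obtain ⟨j, hj⟩ := Int.not_odd_iff_even.1 hP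
    rw [hj] at hqP
    have : (q : ℤ) * (j + j) = 2 * (q * j) := by ring
    lia
  obtain ⟨X, ℓ, hX⟩ := exists_isRigidOrbit (lam := lam) (by linarith) hH0
    ((Int.odd_coe_nat q).2 hq) hqP
  have hW0 := hX.le_weight hH0 0 q
  have hWH := hX.le_weight hH0 H q
  have hWW := hX.weight_le_mul_weight hl hqP hqH hP
  have hlow := hX.iterate_lower hl hH0 hq hqP hqH (dvd_zero H)
  have hlowH := hX.iterate_lower hl hH0 hq hqP hqH dvd_rfl
  have hup := hX.iterate_upper hl hH0 hq hqP hqH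
  rw [halfSign_low le_rfl hH0, neg_neg, zpow_one] at hlow
  rw [halfSign_high le_rfl (by lia), zpow_neg_one] at hlowH
  set W := IsRigidOrbit.weight ℓ (p + p') 0 q
  set W' := IsRigidOrbit.weight ℓ (p + p') H q
  set r := X (p + p')
  have hq1 : (0 : ℝ) < q := by positivity
  have hWpos : 0 < W := by linarith
  have hWpos' : 0 < W' := by linarith
  have hab : r - 1 / W ≤ r - lam⁻¹ / W' := by
    have : lam⁻¹ / W' ≤ 1 / W := by
      rw [inv_eq_one_div, div_div]
      exact one_div_le_one_div_of_le hWpos hWW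
    linarith
  have τmono : Monotone fun s => (trapLift hl s).translationNumber :=
    CircleDeg1Lift.translationNumber_mono.comp (trapLift_mono hl)
  have h1 : p / q ≤ (trapLift hl (r - lam / W)).translationNumber :=
    div_le_translationNumber hq0 hlow.ge
  have h2 : (trapLift hl (r - 1 / W)).translationNumber ≤ p / q :=
    (τmono hab).trans (translationNumber_le_div hq0 hlowH.le)
  have h3 : p' / q' ≤ (trapLift hl (r + 1 / W)).translationNumber := by
    refine div_le_translationNumber (x := 0) hq'.pos ?_
    have hle : (trapLift hl r)^[q' - q] (X 2 + p) ≤ (trapLift hl (r + 1 / W))^[q' - q] (X 2 + p) :=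
      Monotone.iterate_le_of_le (trapLift hl r).monotone
        (trapLift_mono hl (by have := one_div_pos.2 hWpos; linarith)) _ _
    have hp : (trapLift hl r)^[q' - q] (X 2 + p) = (trapLift hl r)^[q' - q] (X 2) + p := by
      rw [← CircleDeg1Lift.coe_pow, CircleDeg1Lift.map_add_int]
    rw [hp, hX.iterate_rigid hl hH0, show 2 + ((q' - q : ℕ) : ℤ) * (p + p') =
      0 + (p' - p) * (2 * H) by push_cast [hqq]; rw [← hH]; linear_combination (-2) * hdet,
      hX.period_mul, hX.zero, ← hup, ← Function.iterate_add_apply, Nat.sub_add_cancel hqq] at hle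
    push_cast at hle
    linarith
  refine ⟨r, W, hW0, fun s hs => le_antisymm ((τmono hs.2).trans h2) (h1.trans (τmono hs.1)),
    fun t ht ht' => abs_le.2 ⟨?_, ?_⟩⟩
  · by_contra! h
    exact (ht.trans_le (τmono (show t ≤ r - 1 / W by linarith))).not_ge h2
  · by_contra! h
    exact (ht'.trans_le h3).not_ge (τmono (show r + 1 / W ≤ t by linarith))

/-- The fractions `p / q < ρ < p' / q'` are Farey neighbours. -/
structure IsFareyPair (ρ : ℝ) (p : ℤ) (q : ℕ) (p' : ℤ) (q' : ℕ) : Prop where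
  pos_left : 0 < q
  pos_right : 0 < q'
  det : p' * q - p * q' = 1
  left : 0 < q * ρ - p
  right : 0 < p' - q' * ρ

namespace IsFareyPair

variable {ρ : ℝ} {p p' : ℤ} {q q' : ℕ}

lemma neg (h : IsFareyPair ρ p q p' q') : IsFareyPair (-ρ) (-p') q' (-p) q where
  pos_left := h.pos_right
  pos_right := h.pos_left
  det := by linear_combination h.det
  left := by have := h.right; push_cast; linarith
  right := by have := h.left; push_cast; linarith

lemma advance_left (h : IsFareyPair ρ p q p' q') (hρ : Irrational ρ) :
    ∃ n : ℕ, IsFareyPair ρ (p + n * p') (q + n * q')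
      (p' + (p + n * p')) (q' + (q + n * q')) := by
  obtain ⟨h1, h2, h3, h4, h5⟩ := h
  set x := q * ρ - p with hx
  set y := p' - q' * ρ with hy
  set n := ⌊x / y⌋₊
  have hn0 : n * y ≤ x := (le_div_iff₀ h5).1 (Nat.floor_le (by positivity))
  have hn1 : x < (n + 1) * y := (div_lt_iff₀ h5).1 (Nat.lt_floor_add_one _)
  have hq : 0 < q + n * q' := by positivity
  have hne : x - n * y ≠ 0 := by
    have := ((hρ.natCast_mul hq.ne').sub_intCast (p + n * p')).ne_zero
    convert this using 1
    rw [hx, hy]; push_cast; ring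
  refine ⟨n, hq, by positivity, ?_, ?_, ?_⟩
  · push_cast; linear_combination h3
  · have := lt_of_le_of_ne (sub_nonneg.2 hn0) hne.symm
    rw [hx, hy] at this
    push_cast; linarith
  · rw [hx, hy] at hn1
    push_cast; linarith

lemma advance_right (h : IsFareyPair ρ p q p' q') (hρ : Irrational ρ) :
    ∃ n : ℕ, IsFareyPair ρ (p + (p' + n * p)) (q + (q' + n * q)) (p' + n * p) (q' + n * q) := by
  obtain ⟨n, hn⟩ := h.neg.advance_left hρ.neg
  refine ⟨n, ?_⟩
  have := hn.neg
  rw [neg_neg] at this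
  convert this using 1 <;> ring

lemma exists_le (hρ : Irrational ρ) (N : ℕ) :
    ∃ p q p' q', IsFareyPair ρ p q p' q' ∧ N ≤ q ∧ N ≤ q' := by
  induction N with
  | zero =>
    refine ⟨⌊ρ⌋, 1, ⌊ρ⌋ + 1, 1, ⟨one_pos, one_pos, by push_cast; ring, ?_, ?_⟩, by simp, by simp⟩
    · have := lt_of_le_of_ne (Int.floor_le ρ) (hρ.ne_int _).symm
      push_cast; linarith
    · have := Int.lt_floor_add_one ρ
      push_cast; linarith
  | succ N ih =>
    obtain ⟨p, q, p', q', h, h1, h2⟩ := ih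
    obtain ⟨n, hn⟩ := h.advance_left hρ
    obtain ⟨m, hm⟩ := hn.advance_right hρ
    have e1 := h.pos_left
    have e2 := h.pos_right
    have e3 := hn.pos_left
    refine ⟨_, _, _, _, hm, ?_, ?_⟩
    · have : 0 ≤ n * q' := zero_le
      have : 0 ≤ m * (q + n * q') := zero_le
      lia
    · have : 0 ≤ n * q' := zero_le
      have : 0 ≤ m * (q + n * q') := zero_le
      lia

lemma exists_odd_le (hρ : Irrational ρ) (N : ℕ) :
    ∃ p q p' q', IsFareyPair ρ p q p' q' ∧ Odd q ∧ Odd q' ∧ N ≤ q ∧ N ≤ q' := by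
  obtain ⟨p, q, p', q', h, h1, h2⟩ := exists_le hρ N
  rcases Nat.even_or_odd q with hq | hq <;> rcases Nat.even_or_odd q' with hq' | hq'
  · obtain ⟨i, rfl⟩ := hq
    obtain ⟨j, rfl⟩ := hq'
    have := h.det
    push_cast at this
    have : 2 * (p' * i - p * j) = 1 := by linear_combination this
    lia
  · obtain ⟨n, hn⟩ := h.advance_right hρ
    have e : Odd (q' + n * q) := hq'.add_even (hq.mul_left n)
    exact ⟨_, _, _, _, hn, hq.add_odd e, e, by lia, by nlinarith⟩
  · obtain ⟨n, hn⟩ := h.advance_left hρ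
    have e : Odd (q + n * q') := hq.add_even (hq'.mul_left n)
    exact ⟨_, _, _, _, hn, e, hq'.add_odd e, by nlinarith, by lia⟩
  · exact ⟨_, _, _, _, h, hq, hq', h1, h2⟩

end IsFareyPair

/-- A subset of the line having, next to each of its points, relatively large holes at arbitrarily
small scales is negligible. -/
lemma volume_eq_zero_of_holes {lam : ℝ} (hl : 1 < lam) {s : Set ℝ}
    (hs : ∀ t ∈ s, ∀ N : ℕ, ∃ r W : ℝ, N ≤ W ∧
      Disjoint s (Icc (r - lam / W) (r - 1 / W)) ∧ |t - r| ≤ 1 / W) :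
    MeasureTheory.volume s = 0 := by
  have hd := Besicovitch.ae_tendsto_measure_inter_div MeasureTheory.volume s
  refine le_antisymm (le_trans ?_ (MeasureTheory.ae_iff.1 hd).le) zero_le
  refine le_trans (MeasureTheory.measure_mono ?_) (MeasureTheory.Measure.le_restrict_apply _ _)
  intro t ht
  refine ⟨fun hlim => ?_, ht⟩
  set c : ℝ := 1 - (lam - 1) / (2 * (lam + 1)) with hc
  have hc1 : ENNReal.ofReal c < 1 := by
    rw [ENNReal.ofReal_lt_one, hc]
    have : 0 < (lam - 1) / (2 * (lam + 1)) := div_pos (by linarith) (by linarith)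
    linarith
  have hev := hlim.eventually (lt_mem_nhds hc1)
  rw [eventually_iff, mem_nhdsGT_iff_exists_Ioo_subset] at hev
  obtain ⟨ε₀, hε₀, hev⟩ := hev
  obtain ⟨N, hN⟩ := exists_nat_gt ((lam + 1) / ε₀)
  obtain ⟨r, W, hNW, hdisj, htr⟩ := hs t ht N
  have hε₀' : 0 < ε₀ := hε₀
  have hW : (lam + 1) / ε₀ < W := hN.trans_le hNW
  have hW0 : 0 < W := lt_trans (by positivity) hW
  have hε : (lam + 1) / W < ε₀ := by
    rw [div_lt_iff₀ hε₀'] at hW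
    rw [div_lt_iff₀ hW0]; linarith
  have hεpos : 0 < (lam + 1) / W := by positivity
  have hlt := hev (show (lam + 1) / W ∈ Ioo 0 ε₀ from ⟨hεpos, hε⟩)
  refine absurd (show ENNReal.ofReal c < _ from hlt) (not_lt.2 ?_)
  have htr' := abs_le.1 htr
  have hsplit : (lam + 1) / W = lam / W + 1 / W := add_div _ _ _
  have hsub : Icc (r - lam / W) (r - 1 / W) ⊆ Metric.closedBall t ((lam + 1) / W) := by
    intro x hx
    rw [Real.closedBall_eq_Icc, hsplit]
    have : 1 / W ≤ lam / W := by gcongr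
    exact ⟨by linarith [hx.1], by linarith [hx.2]⟩
  have hle : MeasureTheory.volume (s ∩ Metric.closedBall t ((lam + 1) / W)) ≤
      MeasureTheory.volume (Metric.closedBall t ((lam + 1) / W) \
        Icc (r - lam / W) (r - 1 / W)) :=
    MeasureTheory.measure_mono fun x hx => ⟨hx.2, hdisj.notMem_of_mem_left hx.1⟩
  rw [MeasureTheory.measure_sdiff hsub measurableSet_Icc.nullMeasurableSet (by simp),
    Real.volume_closedBall, Real.volume_Icc, ← ENNReal.ofReal_sub _ (sub_nonneg.2 (by
      have : 1 / W ≤ lam / W := by gcongr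
      linarith))] at hle
  rw [Real.volume_closedBall]
  refine ENNReal.div_le_of_le_mul (hle.trans ?_)
  rw [← ENNReal.ofReal_mul' (by positivity), hc]
  refine ENNReal.ofReal_le_ofReal (le_of_eq ?_)
  field_simp
  ring

lemma baseMap_reflect {lam : ℝ} (hl : 1 < lam) (y : ℝ) :
    baseMap lam (lam / (1 + lam) - y) = 1 - lam / (1 + lam) - baseMap lam y := by
  have hL1 := break_lt_one hl
  have h0 := Int.floor_le y
  have h1 := Int.lt_floor_add_one y
  rcases le_total y (⌊y⌋ + lam / (1 + lam)) with h | h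
  · rw [baseMap_low hl ⌊y⌋ h0 h, baseMap_low hl (-⌊y⌋) (by push_cast; linarith)
      (by push_cast; linarith)]
    push_cast
    field_simp
    ring
  · rw [baseMap_high hl ⌊y⌋ h h1.le, baseMap_high hl (-⌊y⌋ - 1) (by push_cast; linarith)
      (by push_cast; linarith)]
    push_cast
    field_simp
    ring

lemma translationNumber_reflect {lam : ℝ} (hl : 1 < lam) (t : ℝ) :
    (trapLift hl (2 * (lam / (1 + lam)) - 1 - t)).translationNumber =
      -(trapLift hl t).translationNumber := by
  set t' := 2 * (lam / (1 + lam)) - 1 - t with ht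
  have hiter : ∀ (n : ℕ) (y : ℝ), (trapLift hl t')^[n] (lam / (1 + lam) - y) =
      lam / (1 + lam) - (trapLift hl t)^[n] y := by
    intro n y
    induction n with
    | zero => rfl
    | succ n ih =>
      rw [Function.iterate_succ_apply', Function.iterate_succ_apply', ih, trapLift_apply,
        trapLift_apply, baseMap_reflect hl, ht]
      ring
  refine tendsto_nhds_unique ((trapLift hl t').tendsto_translationNumber (lam / (1 + lam))) ?_
  refine ((trapLift hl t).tendsto_translationNumber 0).neg.congr fun n => ?_
  have := hiter n 0
  rw [sub_zero] at this
  rw [CircleDeg1Lift.coe_pow, CircleDeg1Lift.coe_pow, this]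
  ring

/-- In the family of translates of `baseMap`, almost every translation number is rational. -/
theorem volume_irrational_translationNumber {lam : ℝ} (hl : 1 < lam) :
    MeasureTheory.volume {t | Irrational (trapLift hl t).translationNumber} = 0 := by
  set E : Set ℝ := {t | Irrational (trapLift hl t).translationNumber ∧
    ∀ N : ℕ, ∃ p q p' q', IsFareyPair (trapLift hl t).translationNumber p q p' q' ∧
      Odd q ∧ Odd q' ∧ N ≤ q ∧ q ≤ q'} with hE
  have hE0 : MeasureTheory.volume E = 0 := by
    refine volume_eq_zero_of_holes hl fun t ht N => ?_
    obtain ⟨p, q, p', q', hF, hq, hq', hN, hqq⟩ := ht.2 N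
    obtain ⟨r, W, hW, hhole, hclose⟩ := exists_hole hl hq hq' hqq hF.det
    refine ⟨r, W, le_trans (by exact_mod_cast hN) hW, ?_, hclose t ?_ ?_⟩
    · refine disjoint_left.2 fun x hx hx' => hx.1 ⟨p / q, ?_⟩
      rw [hhole x hx']; push_cast; rfl
    · rw [div_lt_iff₀ (by exact_mod_cast hF.pos_left)]; linarith [hF.left]
    · rw [lt_div_iff₀ (by exact_mod_cast hF.pos_right)]; linarith [hF.right]
  have hE1 := (MeasureTheory.Measure.measurePreserving_sub_left MeasureTheory.volume
    (2 * (lam / (1 + lam)) - 1)).quasiMeasurePreserving.preimage_null hE0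
  refine MeasureTheory.measure_mono_null (fun t ht => ?_) (MeasureTheory.measure_union_null hE0 hE1)
  by_cases h : t ∈ E
  · exact Or.inl h
  · right
    have ht : Irrational (trapLift hl t).translationNumber := ht
    have hN₀ : ¬ ∀ N : ℕ, ∃ p q p' q', IsFareyPair (trapLift hl t).translationNumber p q p' q' ∧
      Odd q ∧ Odd q' ∧ N ≤ q ∧ q ≤ q' := fun h' => h ⟨ht, h'⟩
    push Not at hN₀
    obtain ⟨N₀, hN₀⟩ := hN₀
    rw [mem_preimage, hE, mem_ofPred_eq, translationNumber_reflect hl]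
    refine ⟨ht.neg, fun N => ?_⟩
    obtain ⟨p, q, p', q', hF, hq, hq', h1, h2⟩ := IsFareyPair.exists_odd_le ht (max N N₀)
    exact ⟨_, _, _, _, hF.neg, hq', hq, (le_max_left _ _).trans h2,
      (hN₀ p q p' q' hF hq hq' ((le_max_right _ _).trans h1)).le⟩

/-- The translation number of the family `trapLift`, as a function of both parameters. -/
noncomputable def trapNumber (x : ℝ × ℝ) : ℝ :=
  if h : 1 < x.1 then (trapLift h x.2).translationNumber else 0

lemma measurable_baseMap {f g : ℝ × ℝ → ℝ} (hf : Measurable f) (hg : Measurable g) :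
    Measurable fun x => baseMap (f x) (g x) := by
  unfold baseMap
  have h1 : Measurable fun x => ((⌊g x⌋ : ℤ) : ℝ) :=
    (measurable_from_top (f := fun n : ℤ => (n : ℝ))).comp hg.floor
  have h2 : Measurable fun x => Int.fract (g x) := measurable_fract.comp hg
  exact h1.add ((h2.div hf).max (measurable_const.sub (hf.mul (measurable_const.sub h2))))

lemma measurable_trapNumber : Measurable trapNumber := by
  have hiter : ∀ n : ℕ, Measurable fun x : ℝ × ℝ => (fun y => x.2 + baseMap x.1 y)^[n] 0 := by
    intro n
    induction n with
    | zero => exact measurable_const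
    | succ n ih =>
      simp only [Function.iterate_succ_apply']
      exact measurable_snd.add (measurable_baseMap measurable_fst ih)
  have hset : MeasurableSet {x : ℝ × ℝ | 1 < x.1} := measurableSet_lt measurable_const measurable_fst
  refine measurable_of_tendsto_metrizable
    (f := fun (n : ℕ) (x : ℝ × ℝ) =>
      if 1 < x.1 then (fun y => x.2 + baseMap x.1 y)^[n] 0 / (n : ℝ) else 0)
    (fun n => Measurable.ite hset ((hiter n).div_const _) measurable_const)
    (tendsto_pi_nhds.2 fun x => ?_)
  by_cases h : 1 < x.1
  · simp only [trapNumber, h, if_true, dif_pos]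
    refine ((trapLift h x.2).tendsto_translationNumber 0).congr fun n => ?_
    rw [CircleDeg1Lift.coe_pow, sub_zero]
    rfl
  · simp [trapNumber, h]

lemma volume_irrational_trapNumber :
    MeasureTheory.volume {x : ℝ × ℝ | Irrational (trapNumber x)} = 0 := by
  have hm : MeasurableSet {x : ℝ × ℝ | Irrational (trapNumber x)} :=
    measurable_trapNumber (countable_range ((↑) : ℚ → ℝ)).measurableSet.compl
  rw [MeasureTheory.Measure.volume_eq_prod, MeasureTheory.Measure.measure_prod_null hm]
  refine Eventually.of_forall fun lam => ?_
  by_cases h : 1 < lam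
  · simpa [preimage, trapNumber, h] using volume_irrational_translationNumber h
  · simp [preimage, trapNumber, h]

section Parameters

variable {ℓ α θ : ℝ}

lemma one_lt_Lam (hα : 0 < α) (hαθ : α < θ) (hθ : θ < π / 2) : 1 < Lam α θ := by
  have h1 : 0 < sin (θ - α) := sin_pos_of_pos_of_lt_pi (by linarith) (by linarith)
  have h2 : 0 < sin α := sin_pos_of_pos_of_lt_pi hα (by linarith)
  have h3 : 0 < cos θ := cos_pos_of_mem_Ioo ⟨by linarith, hθ⟩
  rw [Lam, one_lt_div h1, sin_add, sin_sub]
  nlinarith [mul_pos h2 h3]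

lemma Lam_eq (hα : 0 < α) (hαθ : α < θ) (hθ : θ < π / 2) :
    Lam α θ = (tan θ + tan α) / (tan θ - tan α) := by
  have h1 : 0 < cos α := cos_pos_of_mem_Ioo ⟨by linarith, by linarith⟩
  have h3 : 0 < cos θ := cos_pos_of_mem_Ioo ⟨by linarith, hθ⟩
  rw [Lam, sin_add, sin_sub, tan_eq_sin_div_cos, tan_eq_sin_div_cos,
    div_add_div _ _ h3.ne' h1.ne', div_sub_div _ _ h3.ne' h1.ne',
    div_div_div_cancel_right₀ (by positivity)]

lemma brk0_sub_brk1 (hα : 0 < α) (hαθ : α < θ) (hθ : θ < π / 2) :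
    brk0 ℓ θ - brk1 ℓ α θ = Lam α θ / (1 + Lam α θ) := by
  have h1 : 0 < tan α := tan_pos_of_pos_of_lt_pi_div_two hα (by linarith)
  have h2 : 0 < tan θ - tan α :=
    sub_pos.2 (tan_lt_tan_of_nonneg_of_lt_pi_div_two hα.le hθ hαθ)
  have h3 : 0 < tan θ := by linarith
  have h4 : tan θ - tan α + (tan θ + tan α) ≠ 0 := by linarith
  rw [Lam_eq hα hαθ hθ, brk0, brk1]
  field_simp
  ring

lemma Ftrap_eq (hα : 0 < α) (hαθ : α < θ) (hθ : θ < π / 2) (x : ℝ) :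
    Ftrap ℓ α θ x = brk1 ℓ α θ +
      trapLift (one_lt_Lam hα hαθ hθ) (-2 * brk1 ℓ α θ) (x - brk1 ℓ α θ) := by
  have hl := one_lt_Lam hα hαθ hθ
  have hb := brk0_sub_brk1 (ℓ := ℓ) hα hαθ hθ
  have h0 := Int.floor_le (x - brk1 ℓ α θ)
  have h1 := Int.lt_floor_add_one (x - brk1 ℓ α θ)
  rw [Ftrap, Ftrap0, trapLift_apply]
  set m := ⌊x - brk1 ℓ α θ⌋
  have hb' : brk0 ℓ θ = brk1 ℓ α θ + Lam α θ / (1 + Lam α θ) := by linarith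
  split_ifs with h
  · rw [baseMap_low hl m h0 (by linarith)]
    ring
  · rw [baseMap_high hl m (by linarith) h1.le, hb']
    field_simp
    ring

lemma rotationNumber_Ftrap (hα : 0 < α) (hαθ : α < θ) (hθ : θ < π / 2) :
    rotationNumber (Ftrap ℓ α θ) = trapNumber (Lam α θ, -2 * brk1 ℓ α θ) := by
  have hl := one_lt_Lam hα hαθ hθ
  have hiter : ∀ n : ℕ, (Ftrap ℓ α θ)^[n] 0 = brk1 ℓ α θ +
      (trapLift hl (-2 * brk1 ℓ α θ))^[n] (-brk1 ℓ α θ) := by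
    intro n
    induction n with
    | zero => simp
    | succ n ih =>
      rw [Function.iterate_succ_apply', Function.iterate_succ_apply', ih, Ftrap_eq hα hαθ hθ,
        add_sub_cancel_left]
  rw [trapNumber, dif_pos hl]
  refine Tendsto.limUnder_eq
    (((trapLift hl (-2 * brk1 ℓ α θ)).tendsto_translationNumber (-brk1 ℓ α θ)).congr fun n => ?_)
  rw [hiter, CircleDeg1Lift.coe_pow]
  ring

end Parameters

/-- The angles `(α, θ)` recovered from `(Λ, -2 a₁)`. -/
noncomputable def angles (ℓ : ℝ) (x : ℝ × ℝ) : ℝ × ℝ :=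
  (arctan ((x.1 - 1) / (x.1 + 1) / ((x.2 - (x.1 - 1) / (x.1 + 1)) / (2 * ℓ))),
    arctan ((x.2 - (x.1 - 1) / (x.1 + 1)) / (2 * ℓ))⁻¹)

lemma differentiableOn_angles (ℓ : ℝ) :
    DifferentiableOn ℝ (angles ℓ)
      {x | x.1 + 1 ≠ 0 ∧ (x.2 - (x.1 - 1) / (x.1 + 1)) / (2 * ℓ) ≠ 0} := by
  rintro x ⟨h1, h2⟩
  unfold angles
  simp only [div_eq_mul_inv _ (2 * ℓ)] at h2 ⊢
  exact (DifferentiableAt.arctan (by fun_prop (disch := assumption))).prodMk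
    (DifferentiableAt.arctan (by fun_prop (disch := assumption))) |>.differentiableWithinAt

lemma angles_eq {ℓ α θ : ℝ} (hℓ : 0 < ℓ) (hα : 0 < α) (hαθ : α < θ) (hθ : θ < π / 2) :
    (-2 * brk1 ℓ α θ - (Lam α θ - 1) / (Lam α θ + 1)) / (2 * ℓ) ≠ 0 ∧
      angles ℓ (Lam α θ, -2 * brk1 ℓ α θ) = (α, θ) := by
  have h1 : 0 < tan α := tan_pos_of_pos_of_lt_pi_div_two hα (by linarith)
  have h2 : 0 < tan θ - tan α :=
    sub_pos.2 (tan_lt_tan_of_nonneg_of_lt_pi_div_two hα.le hθ hαθ)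
  have h3 : 0 < tan θ := by linarith
  have h4 : tan θ + tan α + (tan θ - tan α) ≠ 0 := by linarith
  have hu : (Lam α θ - 1) / (Lam α θ + 1) = tan α / tan θ := by
    rw [Lam_eq hα hαθ hθ]
    field_simp
    ring
  have hv : (-2 * brk1 ℓ α θ - (Lam α θ - 1) / (Lam α θ + 1)) / (2 * ℓ) = (tan θ)⁻¹ := by
    rw [hu, brk1]
    field_simp
    ring
  refine ⟨hv ▸ (inv_pos.2 h3).ne', ?_⟩
  rw [angles]
  dsimp only
  rw [hv, hu, inv_inv, div_div, mul_inv_cancel₀ h3.ne', div_one,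
    arctan_tan (by linarith) (by linarith), arctan_tan (by linarith) hθ]

/-- for every ℓ > 0, the set of admissible parameter pairs (α, θ)
for which the rotation number of F_{ℓ,α,θ} is irrational has 2-dimensional
Lebesgue measure zero. -/
theorem stmt0 (ℓ : ℝ) (hℓ : 0 < ℓ) :
    MeasureTheory.volume {p : ℝ × ℝ |
      0 < p.1 ∧ p.1 < p.2 ∧ p.2 < π / 2 ∧
      Real.tan p.2 > 2 * ℓ + Real.tan p.1 ∧
      Irrational (rotationNumber (Ftrap ℓ p.1 p.2))} = 0 := by
  refine MeasureTheory.measure_mono_null ?_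
    (MeasureTheory.addHaar_image_eq_zero_of_differentiableOn_of_addHaar_eq_zero
      MeasureTheory.volume ((differentiableOn_angles ℓ).mono inter_subset_right)
      (MeasureTheory.measure_mono_null inter_subset_left volume_irrational_trapNumber))
  rintro ⟨α, θ⟩ ⟨hα, hαθ, hθ, -, hirr⟩
  rw [rotationNumber_Ftrap hα hαθ hθ] at hirr
  obtain ⟨hne, hang⟩ := angles_eq hℓ hα hαθ hθ
  have := one_lt_Lam hα hαθ hθ
  exact ⟨_, ⟨hirr, by linarith, hne⟩, hang⟩
end

section
/- If the rotation number ρ(F_{ℓ,α,θ}) is irrational, then the induced circle homeomorphism is topologically conjugate to the rotation by ρ(F_{ℓ,α,θ}): there exists a continuous, strictly increasing map H : ℝ → ℝ with H(x+1) = H(x)+1 for all x and H(F_{ℓ,α,θ}(x)) = H(x) + ρ(F_{ℓ,α,θ}) for all x ∈ ℝ. In particular, every orbit of the circle map is dense: for every x ∈ ℝ, the set {F_{ℓ,α,θ}ⁿ(x) + k : n ∈ ℕ, k ∈ ℤ} is dense in ℝ. -/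
open Real Filter Set

/-- Best approximation denominators of an irrational number: there are arbitrarily large `q` such
that `q * ρ` is closer to an integer than `i * ρ` for all `0 < i < q`. -/
theorem Irrational.exists_best_approx_denominator {ρ : ℝ} (hρ : Irrational ρ) (N : ℕ) :
    ∃ q : ℕ, N < q ∧ ∃ p : ℤ, ∀ i : ℕ, 0 < i → i < q → ∀ m : ℤ,
      |q * ρ - p| < |i * ρ - m| := by
  classical
  set d : ℕ → ℝ := fun i => |i * ρ - round (i * ρ)| with hd
  have hpos : ∀ i : ℕ, 0 < i → 0 < d i := fun i hi =>
    abs_pos.2 (sub_ne_zero.2 ((hρ.natCast_mul hi.ne').ne_int _))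
  obtain ⟨M, hM, hMd⟩ : ∃ M : ℝ, 0 < M ∧ ∀ i : ℕ, 0 < i → i ≤ N → M ≤ d i := by
    induction N with
    | zero => exact ⟨1, one_pos, fun i hi hi' => absurd hi' (by omega)⟩
    | succ N ih =>
      obtain ⟨M, hM, h⟩ := ih
      refine ⟨min M (d (N + 1)), lt_min hM (hpos _ N.succ_pos), fun i hi hi' => ?_⟩
      rcases hi'.lt_or_eq with hlt | rfl
      · exact (min_le_left _ _).trans (h i hi (by omega))
      · exact min_le_right _ _
  have hex : ∃ q : ℕ, 0 < q ∧ d q < M := by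
    obtain ⟨n, hn⟩ := exists_nat_one_div_lt hM
    obtain ⟨k, hk, -, hle⟩ := Real.exists_nat_abs_mul_sub_round_le ρ n.succ_pos
    refine ⟨k, hk, hle.trans_lt (lt_of_le_of_lt ?_ hn)⟩
    push_cast
    gcongr
    linarith
  obtain ⟨hq0, hqM⟩ := Nat.find_spec hex
  refine ⟨Nat.find hex, ?_, round (Nat.find hex * ρ), fun i hi hiq m => ?_⟩
  · by_contra! h
    exact (hMd _ hq0 h).not_gt hqM
  · have h : ¬ d i < M := fun h => Nat.find_min hex hiq ⟨hi, h⟩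
    exact (hqM.trans_le (not_lt.1 h)).trans_le (round_le _ m)

/-- The forward orbit of an irrational rotation is dense modulo one. -/
theorem Irrational.exists_nat_mul_add_int_mem_Ioo {ρ : ℝ} (hρ : Irrational ρ) {u v : ℝ}
    (huv : u < v) : ∃ (n : ℕ) (k : ℤ), n * ρ + k ∈ Ioo u v := by
  obtain ⟨n, hn⟩ := exists_nat_one_div_lt (sub_pos.2 huv)
  obtain ⟨q, hq, -, hle⟩ := Real.exists_nat_abs_mul_sub_round_le ρ n.succ_pos
  set p := round (q * ρ)
  set δ : ℝ := q * ρ - p with hδ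
  have hδ0 : δ ≠ 0 := sub_ne_zero.2 ((hρ.natCast_mul hq.ne').ne_int _)
  have hδ1 : |δ| < v - u := by
    refine hle.trans_lt (lt_of_le_of_lt ?_ hn)
    push_cast
    gcongr
    linarith
  rcases hδ0.lt_or_gt with hneg | hpos
  · rw [abs_of_neg hneg] at hδ1
    have hK : 0 ≤ (⌈v⌉ - v) / (-δ) := div_nonneg (sub_nonneg.2 (Int.le_ceil v)) (by linarith)
    have h1 := Nat.floor_le hK
    have h2 := Nat.lt_floor_add_one ((⌈v⌉ - v) / (-δ))
    set m := ⌊(⌈v⌉ - v) / (-δ)⌋₊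
    rw [le_div_iff₀ (by linarith)] at h1
    rw [div_lt_iff₀ (by linarith)] at h2
    refine ⟨(m + 1) * q, ⌈v⌉ - (m + 1) * p, ?_⟩
    have : (((m + 1) * q : ℕ) : ℝ) * ρ + ((⌈v⌉ - (m + 1) * p : ℤ) : ℝ) = (m + 1) * δ + ⌈v⌉ := by
      push_cast
      rw [hδ]
      ring
    rw [this]
    constructor <;> linarith
  · rw [abs_of_pos hpos] at hδ1
    have hK : 0 ≤ (u - ⌊u⌋) / δ := div_nonneg (sub_nonneg.2 (Int.floor_le u)) hpos.le
    have h1 := Nat.floor_le hK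
    have h2 := Nat.lt_floor_add_one ((u - ⌊u⌋) / δ)
    set m := ⌊(u - ⌊u⌋) / δ⌋₊
    rw [le_div_iff₀ hpos] at h1
    rw [div_lt_iff₀ hpos] at h2
    refine ⟨(m + 1) * q, ⌊u⌋ - (m + 1) * p, ?_⟩
    have : (((m + 1) * q : ℕ) : ℝ) * ρ + ((⌊u⌋ - (m + 1) * p : ℤ) : ℝ) = (m + 1) * δ + ⌊u⌋ := by
      push_cast
      rw [hδ]
      ring
    rw [this]
    constructor <;> linarith

namespace CircleDeg1Lift

variable {f H : CircleDeg1Lift} {ρ : ℝ}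

theorem map_iterate_of_semiconj_add (hH : ∀ x, H (f x) = H x + ρ) (n : ℕ) (x : ℝ) :
    H (f^[n] x) = H x + n * ρ := by
  induction n with
  | zero => simp
  | succ n ih =>
    rw [Function.iterate_succ_apply', hH, ih]
    push_cast
    ring

/-- A semiconjugacy to an irrational rotation is continuous. -/
theorem continuous_of_semiconj_irrational (hρ : Irrational ρ) (hH : ∀ x, H (f x) = H x + ρ) :
    Continuous H := by
  refine H.monotone.continuous_of_denseRange (dense_of_exists_between fun u v huv => ?_)
  obtain ⟨n, k, hu, hv⟩ :=
    hρ.exists_nat_mul_add_int_mem_Ioo (sub_lt_sub_right huv (H 0))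
  refine ⟨_, ⟨f^[n] 0 + k, rfl⟩, ?_⟩
  rw [map_add_int, map_iterate_of_semiconj_add hH]
  constructor <;> linarith

/-- Orbits of a lift that is conjugate to an irrational rotation are dense modulo one. -/
theorem dense_orbit_of_strictMono_semiconj (hρ : Irrational ρ) (hH : ∀ x, H (f x) = H x + ρ)
    (hmono : StrictMono H) (x : ℝ) :
    Dense {y : ℝ | ∃ (n : ℕ) (k : ℤ), y = f^[n] x + (k : ℝ)} := by
  refine dense_of_exists_between fun u v huv => ?_
  obtain ⟨n, k, hu, hv⟩ :=
    hρ.exists_nat_mul_add_int_mem_Ioo (sub_lt_sub_right (hmono huv) (H x))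
  refine ⟨f^[n] x + k, ⟨n, k, rfl⟩, hmono.lt_iff_lt.1 ?_, hmono.lt_iff_lt.1 ?_⟩ <;>
  · rw [map_add_int, map_iterate_of_semiconj_add hH]
    linarith

/-- The iterates of an interval collapsed by a semiconjugacy to an irrational rotation are
disjoint modulo one, so only finitely many of them have length at least `ε`. -/
theorem finite_setOf_le_iterate_sub (hρ : Irrational ρ) (hH : ∀ x, H (f x) = H x + ρ)
    {x y : ℝ} (hxy : H x = H y) {ε : ℝ} (hε : 0 < ε) :
    {n : ℕ | ε ≤ f^[n] y - f^[n] x}.Finite := by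
  have hit := map_iterate_of_semiconj_add hH
  set c : ℕ → ℤ := fun n => ⌊H x + n * ρ⌋ with hc
  set u : ℕ → ℝ := fun n => f^[n] x - c n with hu
  have hHu : ∀ n, H (u n) = Int.fract (H x + n * ρ) := fun n => by
    rw [hu, map_sub_int, hit, hc, Int.self_sub_floor]
  have hHv : ∀ n, H (f^[n] y - c n) = Int.fract (H x + n * ρ) := fun n => by
    rw [map_sub_int, hit, hc, ← hxy, Int.self_sub_floor]
  have hub : ∀ n, -H 0 - 1 ≤ u n ∧ u n ≤ 2 - H 0 := fun n => by
    have h1 := H.le_map_of_map_zero (u n)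
    have h2 := H.map_le_of_map_zero (u n)
    have h3 := Int.lt_floor_add_one (u n)
    have h4 := Int.ceil_lt_add_one (u n)
    have h5 := Int.fract_nonneg (H x + n * ρ)
    have h6 := Int.fract_lt_one (H x + n * ρ)
    rw [hHu] at h1 h2
    constructor <;> linarith
  refine Set.Finite.of_injOn (f := fun n => ⌊u n / ε⌋)
    (t := Set.Icc ⌊(-H 0 - 1) / ε⌋ ⌊(2 - H 0) / ε⌋) ?_ ?_ (Set.finite_Icc _ _)
  · intro n _
    obtain ⟨h1, h2⟩ := hub n
    constructor <;> simp only <;> gcongr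
  · have key : ∀ n m, ε ≤ f^[n] y - f^[n] x → |u n / ε - u m / ε| < 1 → u n ≤ u m →
        n = m := by
      intro n m hn hlt hle
      rw [← sub_div, abs_div, abs_of_pos hε, div_lt_one hε, abs_sub_comm,
        abs_of_nonneg (sub_nonneg.2 hle)] at hlt
      have h1 : H (u n) ≤ H (u m) := H.mono hle
      have h2 : H (u m) ≤ H (f^[n] y - c n) := H.mono (by simp only [hu] at hlt ⊢; linarith)
      rw [hHv, hHu] at h2
      rw [hHu, hHu] at h1
      obtain ⟨z, hz⟩ := Int.fract_eq_fract.1 (h1.antisymm h2)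
      by_contra hne
      have hne' : ((n : ℤ) - m) ≠ 0 := sub_ne_zero.2 (mod_cast hne)
      refine (hρ.intCast_mul hne').ne_int z ?_
      push_cast
      linarith
    intro n hn m hm heq
    have hlt := Int.abs_sub_lt_one_of_floor_eq_floor heq
    rcases le_total (u n) (u m) with h | h
    · exact key n m hn hlt h
    · exact (key m n hm (by rwa [abs_sub_comm]) h).symm

/-- **Denjoy's inequality** for piecewise affine circle homeomorphisms: if `f` is affine away from
the integer translates of the finite set `S` and has all slopes in `[Λ⁻¹, Λ]`, then the lengths of
the iterates of a collapsed interval satisfy a reverse log-convexity estimate at best approximation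
denominators. -/
theorem denjoy_inequality (hH : ∀ x, H (f x) = H x + ρ) {S : Finset ℝ} {Λ : ℝ} (hΛ : 1 ≤ Λ)
    (hlow : ∀ u v, u < v → Λ⁻¹ * (v - u) ≤ f v - f u)
    (hupp : ∀ u v, u < v → f v - f u ≤ Λ * (v - u))
    (haff : ∀ A B, (∀ b ∈ S, ∀ k : ℤ, b + k ∉ Ioo A B) →
      ∃ s, ∀ u ∈ Icc A B, ∀ v ∈ Icc A B, f v - f u = s * (v - u))
    {q : ℕ} {p : ℤ}
    (hq : ∀ i : ℕ, 0 < i → i < q → ∀ m : ℤ, |q * ρ - p| < |i * ρ - m|)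
    {x y : ℝ} (hxy : x < y) (hHxy : H x = H y) :
    (Λ⁻¹ ^ 2) ^ S.card * (f^[q] y - f^[q] x) ^ 2 ≤
      (y - x) * (f^[q + q] y - f^[q + q] x) := by
  classical
  have hΛ0 : 0 < Λ := one_pos.trans_le hΛ
  have hit := map_iterate_of_semiconj_add hH
  have hf : StrictMono f := fun u v huv =>
    sub_pos.1 ((mul_pos (inv_pos.2 hΛ0) (sub_pos.2 huv)).trans_le (hlow u v huv))
  set X : ℕ → ℝ := fun i => f^[i] x with hX
  set Y : ℕ → ℝ := fun i => f^[i] y with hY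
  have hXs : ∀ i, X (i + 1) = f (X i) := fun i => Function.iterate_succ_apply' _ _ _
  have hYs : ∀ i, Y (i + 1) = f (Y i) := fun i => Function.iterate_succ_apply' _ _ _
  set l : ℕ → ℝ := fun i => Y i - X i with hl
  have hl0 : ∀ i, 0 < l i := fun i => sub_pos.2 (hf.iterate i hxy)
  set r : ℕ → ℝ := fun i => l (i + q) / l i with hr
  have hHX : ∀ i, H (X i) = H x + i * ρ := fun i => hit i x
  have hHY : ∀ i, H (Y i) = H x + i * ρ := fun i => by rw [hHxy]; exact hit i y
  set δ : ℝ := q * ρ - p with hδ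
  set bad : ℕ → ℝ → Prop := fun i b => ∃ k : ℤ, H b + k - (H x + i * ρ) ∈ uIcc 0 δ with hbad
  have hgood : ∀ i, (¬ ∃ b ∈ S, bad i b) → r (i + 1) = r i := by
    intro i hi
    push Not at hi
    obtain ⟨s, hs⟩ := haff (min (X i) (X (i + q) - p)) (max (Y i) (Y (i + q) - p)) (by
      rintro b hb k ⟨h1, h2⟩
      refine hi b hb ⟨k, ?_⟩
      have h1 := H.mono h1.le
      have h2 := H.mono h2.le
      rw [H.monotone.map_min, map_add_int, map_sub_int, hHX, hHX] at h1
      rw [H.monotone.map_max, map_add_int, map_sub_int, hHY, hHY] at h2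
      push_cast at h1 h2
      have e : H x + (i + q) * ρ - p = H x + i * ρ + δ := by rw [hδ]; ring
      rw [e] at h1 h2
      rw [Set.mem_uIcc]
      rcases le_total 0 δ with h | h
      · rw [min_eq_left (by linarith)] at h1
        rw [max_eq_right (by linarith)] at h2
        left
        constructor <;> linarith
      · rw [min_eq_right (by linarith)] at h1
        rw [max_eq_left (by linarith)] at h2
        right
        constructor <;> linarith)
    have hi0 : X i < Y i := sub_pos.1 (hl0 i)
    have hiq : X (i + q) < Y (i + q) := sub_pos.1 (hl0 (i + q))
    have h1 := hs (X i) ⟨min_le_left _ _, hi0.le.trans (le_max_left _ _)⟩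
      (Y i) ⟨(min_le_left _ _).trans hi0.le, le_max_left _ _⟩
    have h2 := hs (X (i + q) - p)
      ⟨min_le_right _ _, (sub_le_sub_right hiq.le _).trans (le_max_right _ _)⟩
      (Y (i + q) - p) ⟨(min_le_right _ _).trans (sub_le_sub_right hiq.le _), le_max_right _ _⟩
    rw [map_sub_int, map_sub_int] at h2
    have e1 : l (i + 1) = s * l i := by simp only [hl, hXs, hYs]; exact h1
    have e2 : l (i + 1 + q) = s * l (i + q) := by
      rw [add_right_comm]
      simp only [hl, hXs, hYs]
      linarith
    have hs0 : s ≠ 0 := by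
      rintro rfl
      rw [zero_mul] at e1
      exact (hl0 (i + 1)).ne' e1
    simp only [hr]
    rw [e1, e2, mul_div_mul_left _ _ hs0]
  have hany : ∀ i, Λ⁻¹ ^ 2 ≤ r (i + 1) / r i := by
    intro i
    have h1 : l (i + 1) ≤ Λ * l i := by
      simp only [hl, hXs, hYs]
      exact hupp _ _ (sub_pos.1 (hl0 i))
    have h2 : Λ⁻¹ * l (i + q) ≤ l (i + 1 + q) := by
      rw [add_right_comm]
      simp only [hl, hXs, hYs]
      exact hlow _ _ (sub_pos.1 (hl0 (i + q)))
    have := hl0 i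
    have := hl0 (i + 1)
    have := hl0 (i + q)
    simp only [hr]
    rw [div_div_div_eq, le_div_iff₀ (by positivity)]
    calc Λ⁻¹ ^ 2 * (l (i + 1) * l (i + q)) ≤ Λ⁻¹ ^ 2 * (Λ * l i * l (i + q)) := by gcongr
      _ = (Λ⁻¹ * l (i + q)) * l i := by field_simp
      _ ≤ l (i + 1 + q) * l i := by gcongr
  have hr0 : ∀ i, 0 < r i := fun i => div_pos (hl0 _) (hl0 _)
  set T : Finset ℕ := (Finset.range q).filter fun i => ∃ b ∈ S, bad i b with hT
  have hTcard : T.card ≤ S.card := by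
    have hch : ∀ i, ∃ b, i ∈ T → b ∈ S ∧ bad i b := fun i => by
      by_cases hi : i ∈ T
      · obtain ⟨b, hb⟩ := (Finset.mem_filter.1 hi).2
        exact ⟨b, fun _ => hb⟩
      · exact ⟨0, fun h => absurd h hi⟩
    choose g hg using hch
    have key : ∀ i j, i < j → j < q → ∀ b, bad i b → ¬ bad j b := by
      rintro i j hij hjq b ⟨k, hk⟩ ⟨m, hm⟩
      have h1 := hq (j - i) (by omega) (by omega) (m - k)
      have h2 := Set.abs_sub_le_of_uIcc_subset_uIcc (Set.uIcc_subset_uIcc hk hm)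
      rw [sub_zero, ← hδ] at *
      refine h2.not_gt (h1.trans_eq ?_)
      rw [abs_sub_comm]
      push_cast [Nat.cast_sub hij.le]
      congr 1
      ring
    refine Finset.card_le_card_of_injOn g (fun i hi => (hg i hi).1) fun i hi j hj hij => ?_
    have hiq := Finset.mem_range.1 (Finset.mem_filter.1 hi).1
    have hjq := Finset.mem_range.1 (Finset.mem_filter.1 hj).1
    rcases lt_trichotomy i j with h | h | h
    · exact absurd (hij ▸ (hg j hj).2) (key i j h hjq _ (hg i hi).2)
    · exact h
    · exact absurd (hij ▸ (hg i hi).2) (key j i h hiq _ (hg j hj).2)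
  have hc0 : 0 < Λ⁻¹ ^ 2 := by positivity
  have hc1 : Λ⁻¹ ^ 2 ≤ 1 := pow_le_one₀ (by positivity) (inv_le_one_of_one_le₀ hΛ)
  have hprod : (Λ⁻¹ ^ 2) ^ S.card ≤ r q / r 0 := by
    calc (Λ⁻¹ ^ 2) ^ S.card ≤ (Λ⁻¹ ^ 2) ^ T.card := pow_le_pow_of_le_one hc0.le hc1 hTcard
      _ = ∏ i ∈ Finset.range q, if ∃ b ∈ S, bad i b then Λ⁻¹ ^ 2 else 1 := by
        rw [Finset.prod_ite, Finset.prod_const, Finset.prod_const_one, mul_one]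
      _ ≤ ∏ i ∈ Finset.range q, r (i + 1) / r i := by
        refine Finset.prod_le_prod (fun i _ => by split_ifs <;> positivity) fun i _ => ?_
        split_ifs with h
        · exact hany i
        · rw [hgood i h, div_self (hr0 i).ne']
      _ = r q / r 0 := by
        refine Finset.prod_range_induction _ (fun n => r n / r 0) (div_self (hr0 0).ne') _ fun n _ => ?_
        have := (hr0 n).ne'
        field_simp
  have e : r q / r 0 = l 0 * l (q + q) / l q ^ 2 := by
    have := (hl0 q).ne'
    have := (hl0 0).ne'
    simp only [hr, zero_add]
    field_simp
  rw [e, le_div_iff₀ (pow_pos (hl0 q) 2)] at hprod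
  exact hprod

/-- **Denjoy's theorem** for piecewise affine circle homeomorphisms: a semiconjugacy to an
irrational rotation is injective. -/
theorem strictMono_of_semiconj_irrational (hρ : Irrational ρ) (hH : ∀ x, H (f x) = H x + ρ)
    (hsurj : Function.Surjective f) {S : Finset ℝ} {Λ : ℝ} (hΛ : 1 ≤ Λ)
    (hlow : ∀ u v, u < v → Λ⁻¹ * (v - u) ≤ f v - f u)
    (hupp : ∀ u v, u < v → f v - f u ≤ Λ * (v - u))
    (haff : ∀ A B, (∀ b ∈ S, ∀ k : ℤ, b + k ∉ Ioo A B) →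
      ∃ s, ∀ u ∈ Icc A B, ∀ v ∈ Icc A B, f v - f u = s * (v - u)) :
    StrictMono H := by
  refine H.strictMono_iff_injective.2 (Function.Injective.of_lt_imp_ne fun x y hxy hHxy => ?_)
  have hΛ0 : 0 < Λ := one_pos.trans_le hΛ
  set c : ℝ := (Λ⁻¹ ^ 2) ^ S.card * (y - x) ^ 2 with hc
  have hc0 : 0 < c := mul_pos (by positivity) (pow_pos (sub_pos.2 hxy) 2)
  obtain ⟨N, hN⟩ := (finite_setOf_le_iterate_sub hρ hH hHxy hc0).bddAbove
  obtain ⟨q, hNq, p, hq⟩ := hρ.exists_best_approx_denominator N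
  have hlt : f^[q] y - f^[q] x < c := by
    by_contra! h
    exact (hN h).not_gt hNq
  obtain ⟨x', hx'⟩ := hsurj.iterate q x
  obtain ⟨y', hy'⟩ := hsurj.iterate q y
  have hit := map_iterate_of_semiconj_add hH q
  have hx'y' : x' < y' := by
    by_contra! h
    have := f.monotone.iterate q h
    rw [hx', hy'] at this
    exact this.not_gt hxy
  have hH' : H x' = H y' := by
    have h1 := hit x'
    have h2 := hit y'
    rw [hx'] at h1
    rw [hy'] at h2
    linarith
  have hle : y' - x' ≤ 1 := by
    by_contra! h
    have := H.mono (show x' + 1 ≤ y' by linarith)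
    rw [map_add_one] at this
    linarith
  have hD := denjoy_inequality hH hΛ hlow hupp haff hq hx'y' hH'
  rw [Function.iterate_add_apply, Function.iterate_add_apply, hx', hy'] at hD
  have hnn : 0 ≤ f^[q] y - f^[q] x := sub_nonneg.2 (f.monotone.iterate q hxy.le)
  nlinarith

end CircleDeg1Lift

section Trapezoid

variable {ℓ α θ : ℝ}

/-- The parameter relations that make the two affine pieces of `Ftrap` fit together. -/
theorem Lam_brk_relations (hα : 0 < α) (hαθ : α < θ) (hθ : θ < π / 2) :
    1 < Lam α θ ∧ brk1 ℓ α θ < brk0 ℓ θ ∧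
      brk0 ℓ θ - brk1 ℓ α θ = Lam α θ * (1 - (brk0 ℓ θ - brk1 ℓ α θ)) := by
  have hcθ : 0 < cos θ := cos_pos_of_mem_Ioo ⟨by linarith, hθ⟩
  have hcα : 0 < cos α := cos_pos_of_mem_Ioo ⟨by linarith, by linarith⟩
  have htα : 0 < tan α := tan_pos_of_pos_of_lt_pi_div_two hα (by linarith)
  have htlt : tan α < tan θ := tan_lt_tan_of_lt_of_lt_pi_div_two (by linarith) hθ hαθ
  have htθ : 0 < tan θ := htα.trans htlt
  have hsub : 0 < tan θ - tan α := sub_pos.2 htlt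
  have hΛ : Lam α θ = (tan θ + tan α) / (tan θ - tan α) := by
    have e1 : sin (θ + α) = (tan θ + tan α) * (cos θ * cos α) := by
      rw [sin_add, tan_eq_sin_div_cos, tan_eq_sin_div_cos]
      field_simp
    have e2 : sin (θ - α) = (tan θ - tan α) * (cos θ * cos α) := by
      rw [sin_sub, tan_eq_sin_div_cos, tan_eq_sin_div_cos]
      field_simp
    rw [Lam, e1, e2, mul_div_mul_right _ _ (by positivity)]
  have hL : brk0 ℓ θ - brk1 ℓ α θ = (tan θ + tan α) / (2 * tan θ) := by
    rw [brk0, brk1]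
    field_simp
    ring
  refine ⟨?_, ?_, ?_⟩
  · rw [hΛ, one_lt_div hsub]
    linarith
  · rw [← sub_pos, hL]
    positivity
  · rw [hL, hΛ]
    field_simp
    ring

theorem Ftrap_add_int (x : ℝ) (k : ℤ) : Ftrap ℓ α θ (x + k) = Ftrap ℓ α θ x + k := by
  have : ⌊x + k - brk1 ℓ α θ⌋ = ⌊x - brk1 ℓ α θ⌋ + k := by
    rw [add_sub_right_comm, Int.floor_add_intCast]
  rw [Ftrap, Ftrap, this]
  push_cast
  rw [add_sub_add_right_eq_sub, add_assoc]

theorem Ftrap_of_mem_Icc_left (hlt' : brk0 ℓ θ < brk1 ℓ α θ + 1)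
    {x : ℝ} {k : ℤ} (hx : x ∈ Icc (brk1 ℓ α θ + k) (brk0 ℓ θ + k)) :
    Ftrap ℓ α θ x = -brk1 ℓ α θ + (Lam α θ)⁻¹ * (x - k - brk1 ℓ α θ) + k := by
  have hk : ⌊x - brk1 ℓ α θ⌋ = k := by
    rw [Int.floor_eq_iff]
    constructor <;> linarith [hx.1, hx.2]
  rw [Ftrap, hk, Ftrap0, if_pos (by linarith [hx.2])]

theorem Ftrap_of_mem_Icc_right (hlt : brk1 ℓ α θ < brk0 ℓ θ) (hΛ : 0 < Lam α θ)
    (hrel : brk0 ℓ θ - brk1 ℓ α θ = Lam α θ * (1 - (brk0 ℓ θ - brk1 ℓ α θ)))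
    {x : ℝ} {k : ℤ} (hx : x ∈ Icc (brk0 ℓ θ + k) (brk1 ℓ α θ + 1 + k)) :
    Ftrap ℓ α θ x = 1 - brk0 ℓ θ + Lam α θ * (x - k - brk0 ℓ θ) + k := by
  have hlt' : brk0 ℓ θ < brk1 ℓ α θ + 1 := by
    have := (pos_iff_pos_of_mul_pos (hrel ▸ sub_pos.2 hlt)).1 hΛ
    linarith
  rcases hx.1.eq_or_lt with rfl | h1
  · rw [Ftrap_of_mem_Icc_left hlt' (k := k) ⟨by linarith, le_rfl⟩]
    have : (Lam α θ)⁻¹ * (brk0 ℓ θ - brk1 ℓ α θ) = 1 - (brk0 ℓ θ - brk1 ℓ α θ) := by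
      rw [inv_mul_eq_iff_eq_mul₀ hΛ.ne']
      exact hrel
    rw [add_sub_cancel_right, this]
    ring
  rcases hx.2.eq_or_lt with rfl | h2
  · rw [Ftrap_of_mem_Icc_left hlt' (k := k + 1) ⟨by push_cast; linarith, by push_cast; linarith⟩]
    push_cast
    linear_combination hrel
  · have hk : ⌊x - brk1 ℓ α θ⌋ = k := by
      rw [Int.floor_eq_iff]
      constructor <;> linarith
    rw [Ftrap, hk, Ftrap0, if_neg (by linarith)]

/-- `Ftrap` is affine between consecutive break points. -/
theorem Ftrap_affine (hlt : brk1 ℓ α θ < brk0 ℓ θ) (hΛ : 0 < Lam α θ)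
    (hrel : brk0 ℓ θ - brk1 ℓ α θ = Lam α θ * (1 - (brk0 ℓ θ - brk1 ℓ α θ))) {A B : ℝ}
    (hAB : ∀ b ∈ ({brk0 ℓ θ, brk1 ℓ α θ} : Finset ℝ), ∀ k : ℤ, b + k ∉ Ioo A B) :
    ∃ s, (s = (Lam α θ)⁻¹ ∨ s = Lam α θ) ∧ ∀ u ∈ Icc A B, ∀ v ∈ Icc A B,
      Ftrap ℓ α θ v - Ftrap ℓ α θ u = s * (v - u) := by
  have hlt' : brk0 ℓ θ < brk1 ℓ α θ + 1 := by
    have := (pos_iff_pos_of_mul_pos (hrel ▸ sub_pos.2 hlt)).1 hΛ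
    linarith
  set k : ℤ := ⌊A - brk1 ℓ α θ⌋ with hk
  have h1 := Int.floor_le (A - brk1 ℓ α θ)
  have h2 := Int.lt_floor_add_one (A - brk1 ℓ α θ)
  rw [← hk] at h1 h2
  rcases lt_or_ge A (brk0 ℓ θ + k) with hA | hA
  · have hB : B ≤ brk0 ℓ θ + k := by
      by_contra! h
      exact hAB _ (by simp) k ⟨hA, h⟩
    refine ⟨_, Or.inl rfl, fun u hu v hv => ?_⟩
    rw [Ftrap_of_mem_Icc_left hlt' (x := u) (k := k) ⟨by linarith [hu.1], hu.2.trans hB⟩,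
      Ftrap_of_mem_Icc_left hlt' (x := v) (k := k) ⟨by linarith [hv.1], hv.2.trans hB⟩]
    ring
  · have hB : B ≤ brk1 ℓ α θ + 1 + k := by
      by_contra! h
      exact hAB (brk1 ℓ α θ) (by simp) (k + 1)
        ⟨by push_cast; linarith, by push_cast; linarith⟩
    refine ⟨_, Or.inr rfl, fun u hu v hv => ?_⟩
    rw [Ftrap_of_mem_Icc_right hlt hΛ hrel (x := u) (k := k) ⟨hA.trans hu.1, hu.2.trans hB⟩,
      Ftrap_of_mem_Icc_right hlt hΛ hrel (x := v) (k := k) ⟨hA.trans hv.1, hv.2.trans hB⟩]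
    ring

/-- All difference quotients of `Ftrap` lie between `Λ⁻¹` and `Λ`. -/
theorem Ftrap_sub_mem_Icc (hlt : brk1 ℓ α θ < brk0 ℓ θ) (hΛ : 1 < Lam α θ)
    (hrel : brk0 ℓ θ - brk1 ℓ α θ = Lam α θ * (1 - (brk0 ℓ θ - brk1 ℓ α θ))) {u v : ℝ}
    (huv : u ≤ v) :
    Ftrap ℓ α θ v - Ftrap ℓ α θ u ∈ Icc ((Lam α θ)⁻¹ * (v - u)) (Lam α θ * (v - u)) := by
  have hΛ0 : 0 < Lam α θ := one_pos.trans hΛ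
  have hlt' : brk0 ℓ θ < brk1 ℓ α θ + 1 := by
    have := (pos_iff_pos_of_mul_pos (hrel ▸ sub_pos.2 hlt)).1 hΛ0
    linarith
  have hinv : (Lam α θ)⁻¹ < 1 := inv_lt_one_of_one_lt₀ hΛ
  set P : ℝ → ℝ → Prop := fun u v =>
    Ftrap ℓ α θ v - Ftrap ℓ α θ u ∈ Icc ((Lam α θ)⁻¹ * (v - u)) (Lam α θ * (v - u)) with hP
  have trans : ∀ {u v w}, P u v → P v w → P u w := by
    rintro u v w ⟨h1, h2⟩ ⟨h3, h4⟩
    constructor <;> linarith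
  have left : ∀ (k : ℤ) u v, brk1 ℓ α θ + k ≤ u → u ≤ v → v ≤ brk0 ℓ θ + k → P u v := by
    intro k u v h1 h2 h3
    simp only [hP]
    rw [Ftrap_of_mem_Icc_left hlt' (x := u) (k := k) ⟨h1, h2.trans h3⟩,
      Ftrap_of_mem_Icc_left hlt' (x := v) (k := k) ⟨h1.trans h2, h3⟩]
    constructor <;> nlinarith
  have right : ∀ (k : ℤ) u v, brk0 ℓ θ + k ≤ u → u ≤ v → v ≤ brk1 ℓ α θ + 1 + k → P u v := by
    intro k u v h1 h2 h3
    simp only [hP]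
    rw [Ftrap_of_mem_Icc_right hlt hΛ0 hrel (x := u) (k := k) ⟨h1, h2.trans h3⟩,
      Ftrap_of_mem_Icc_right hlt hΛ0 hrel (x := v) (k := k) ⟨h1.trans h2, h3⟩]
    constructor <;> nlinarith
  have period : ∀ (k : ℤ) u v, brk1 ℓ α θ + k ≤ u → u ≤ v → v ≤ brk1 ℓ α θ + 1 + k →
      P u v := by
    intro k u v h1 h2 h3
    rcases le_total v (brk0 ℓ θ + k) with hv | hv
    · exact left k u v h1 h2 hv
    rcases le_total u (brk0 ℓ θ + k) with hu | hu
    · exact trans (left k _ _ h1 hu le_rfl) (right k _ _ le_rfl hv h3)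
    · exact right k u v hu h2 h3
  set i : ℤ := ⌊u - brk1 ℓ α θ⌋ with hi
  set j : ℤ := ⌊v - brk1 ℓ α θ⌋ with hj
  have hi1 := Int.floor_le (u - brk1 ℓ α θ)
  have hi2 := Int.lt_floor_add_one (u - brk1 ℓ α θ)
  have hj1 := Int.floor_le (v - brk1 ℓ α θ)
  have hj2 := Int.lt_floor_add_one (v - brk1 ℓ α θ)
  rw [← hi] at hi1 hi2
  rw [← hj] at hj1 hj2
  have hij : i ≤ j := by rw [hi, hj]; gcongr
  rcases hij.eq_or_lt with h | h
  · rw [← h] at hj2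
    exact period i u v (by linarith) huv (by linarith)
  · have hij' : ((i + 1 : ℤ) : ℝ) ≤ j := Int.cast_le.2 h
    have hmid : P (brk1 ℓ α θ + (i + 1 : ℤ)) (brk1 ℓ α θ + j) := by
      simp only [hP]
      rw [Ftrap_add_int, Ftrap_add_int]
      constructor <;> nlinarith
    refine trans (period i u (brk1 ℓ α θ + (i + 1 : ℤ)) ?_ ?_ ?_)
      (trans hmid (period j _ v le_rfl ?_ ?_)) <;> push_cast <;> linarith

end Trapezoid

/-- if ρ(F_{ℓ,α,θ}) is irrational, the induced circle map is
topologically conjugate to the rotation by ρ(F_{ℓ,α,θ}); in particular every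
orbit of the circle map is dense. -/
theorem stmt3 (ℓ α θ : ℝ) (hℓ : 0 < ℓ) (hα : 0 < α) (hαθ : α < θ)
    (hθ : θ < π / 2) (htan : Real.tan θ > 2 * ℓ + Real.tan α)
    (hirr : Irrational (rotationNumber (Ftrap ℓ α θ))) :
    (∃ H : ℝ → ℝ, Continuous H ∧ StrictMono H ∧
      (∀ x : ℝ, H (x + 1) = H x + 1) ∧
      (∀ x : ℝ, H (Ftrap ℓ α θ x) = H x + rotationNumber (Ftrap ℓ α θ))) ∧
    ∀ x : ℝ, Dense {y : ℝ | ∃ (n : ℕ) (k : ℤ), y = (Ftrap ℓ α θ)^[n] x + (k : ℝ)} := by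
  obtain ⟨hΛ, hlt, hrel⟩ := Lam_brk_relations (ℓ := ℓ) hα hαθ hθ
  have hbd : ∀ u v, u < v → _ := fun u v huv =>
    Ftrap_sub_mem_Icc (u := u) (v := v) hlt hΛ hrel huv.le
  have hΛ0 : 0 < Lam α θ := one_pos.trans hΛ
  have hmono : StrictMono (Ftrap ℓ α θ) := fun u v huv =>
    sub_pos.1 ((mul_pos (inv_pos.2 hΛ0) (sub_pos.2 huv)).trans_le (hbd u v huv).1)
  have hcont : Continuous (Ftrap ℓ α θ) := by
    refine (LipschitzWith.of_le_add_mul (Lam α θ).toNNReal fun u v => ?_).continuous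
    rw [Real.coe_toNNReal _ hΛ0.le, Real.dist_eq]
    rcases le_or_gt u v with h | h
    · have := mul_nonneg hΛ0.le (abs_nonneg (u - v))
      linarith [hmono.monotone h]
    · rw [abs_of_pos (sub_pos.2 h)]
      linarith [(hbd v u h).2]
  let f : CircleDeg1Lift := ⟨⟨Ftrap ℓ α θ, hmono.monotone⟩, fun x => by
    simpa using Ftrap_add_int (ℓ := ℓ) (α := α) (θ := θ) x 1⟩
  have hf : ⇑f = Ftrap ℓ α θ := rfl
  have hsurj : Function.Surjective f := f.continuous_iff_surjective.1 hcont
  set ρ := rotationNumber (Ftrap ℓ α θ) with hρ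
  have hτ : f.translationNumber = ρ := by
    refine (Tendsto.limUnder_eq ?_).symm
    simpa only [CircleDeg1Lift.coe_pow, hf] using f.tendsto_translation_number₀
  obtain ⟨H, hH⟩ := CircleDeg1Lift.semiconj_of_isUnit_of_translationNumber_eq
    (f₁ := f) (f₂ := CircleDeg1Lift.translate (Multiplicative.ofAdd ρ))
    (CircleDeg1Lift.isUnit_iff_bijective.2 ⟨hmono.injective, hsurj⟩) (Units.isUnit _)
    (by rw [hτ, CircleDeg1Lift.translationNumber_translate])
  have hH' : ∀ x, H (f x) = H x + ρ := fun x => by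
    rw [hH x, CircleDeg1Lift.translate_apply, add_comm]
  have hHmono : StrictMono H :=
    CircleDeg1Lift.strictMono_of_semiconj_irrational hirr hH' hsurj hΛ.le
      (fun u v huv => (hbd u v huv).1) (fun u v huv => (hbd u v huv).2)
      (S := {brk0 ℓ θ, brk1 ℓ α θ}) fun A B hAB =>
        (Ftrap_affine hlt hΛ0 hrel hAB).imp fun _ h => h.2
  exact ⟨⟨H, CircleDeg1Lift.continuous_of_semiconj_irrational hirr hH', hHmono, H.map_add_one,
    hH'⟩, CircleDeg1Lift.dense_orbit_of_strictMono_semiconj hirr hH' hHmono⟩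
end

section
/- Suppose ρ(F_{ℓ,α,θ}) = p/q with p a nonnegative integer, q a positive ODD integer, and gcd(p,q) = 1 (with p = 0, q = 1 allowed). Then there is no nondegenerate interval I ⊂ ℝ such that F_{ℓ,α,θ}^q(x) = x + p for all x ∈ I, and the break points a₀ and a₁ do not lie on the same orbit of the circle map: there are no integers n and k with F_{ℓ,α,θ}ⁿ(a₀) = a₁ + k. -/
open Real Filter Set

/-- The degree-one lift with slope `L⁻¹` on `[b, a]` and slope `L` on `[a, b + 1]`, sending
`b` to `-b` and `a` to `1 - a`. -/
noncomputable def twoSlopeLift (L a b x : ℝ) : ℝ :=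
  (if x - ⌊x - b⌋ ≤ a then -b + L⁻¹ * (x - ⌊x - b⌋ - b)
    else 1 - a + L * (x - ⌊x - b⌋ - a)) + ⌊x - b⌋

namespace twoSlopeLift

variable {L a b : ℝ}

theorem add_int (x : ℝ) (k : ℤ) :
    twoSlopeLift L a b (x + k) = twoSlopeLift L a b x + k := by
  have h : ⌊x + k - b⌋ = ⌊x - b⌋ + k := by
    rw [← Int.floor_add_intCast]; congr 1; ring
  have h' : x + k - ((⌊x - b⌋ : ℝ) + k) = x - ⌊x - b⌋ := by ring
  simp only [twoSlopeLift, h, Int.cast_add, h']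
  ring

theorem sub_mem_Ioo (hL : 1 < L) (hd : a - b = L * (1 - (a - b))) : a - b ∈ Ioo (0 : ℝ) 1 := by
  constructor <;> nlinarith

theorem inv_mul_sub (hL : 1 < L) (hd : a - b = L * (1 - (a - b))) :
    L⁻¹ * (a - b) = 1 - (a - b) := by
  rw [inv_mul_eq_iff_eq_mul₀ (by positivity)]; exact hd

theorem eq_of_mem_left (hL : 1 < L) (hd : a - b = L * (1 - (a - b))) {x : ℝ}
    (hx : x ∈ Icc b a) : twoSlopeLift L a b x = -b + L⁻¹ * (x - b) := by
  have h01 := sub_mem_Ioo hL hd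
  have h : ⌊x - b⌋ = 0 := by
    rw [Int.floor_eq_zero_iff]; constructor <;> linarith [hx.1, hx.2, h01.2]
  simp [twoSlopeLift, h, hx.2]

theorem eq_of_mem_right (hL : 1 < L) (hd : a - b = L * (1 - (a - b))) {x : ℝ}
    (hx : x ∈ Icc a (b + 1)) : twoSlopeLift L a b x = 1 - a + L * (x - a) := by
  have h01 := sub_mem_Ioo hL hd
  have hi := inv_mul_sub hL hd
  rcases hx.2.eq_or_lt with rfl | hlt
  · have h := add_int (L := L) (a := a) (b := b) b 1
    rw [Int.cast_one] at h
    rw [h, eq_of_mem_left hL hd ⟨le_rfl, by linarith [h01.1]⟩]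
    linear_combination hd
  · rcases hx.1.eq_or_lt with rfl | hgt
    · rw [eq_of_mem_left hL hd ⟨by linarith [h01.1], le_rfl⟩]
      linear_combination hi
    · have h : ⌊x - b⌋ = 0 := by
        rw [Int.floor_eq_zero_iff]; constructor <;> linarith [h01.1]
      simp [twoSlopeLift, h, hgt]

theorem exists_eq_add_int (b x : ℝ) : ∃ t ∈ Ico b (b + 1), ∃ k : ℤ, x = t + k :=
  ⟨x - ⌊x - b⌋, ⟨by linarith [Int.floor_le (x - b)], by linarith [Int.lt_floor_add_one (x - b)]⟩,
    ⌊x - b⌋, by ring⟩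

theorem monotone (hL : 1 < L) (hd : a - b = L * (1 - (a - b))) :
    Monotone (twoSlopeLift L a b) := by
  have h01 := sub_mem_Ioo hL hd
  have hL0 : 0 < L := by linarith
  have hLi : 0 < L⁻¹ := by positivity
  have hleft : MonotoneOn (twoSlopeLift L a b) (Icc b a) := fun x hx y hy hxy => by
    rw [eq_of_mem_left hL hd hx, eq_of_mem_left hL hd hy]; gcongr
  have hright : MonotoneOn (twoSlopeLift L a b) (Icc a (b + 1)) := fun x hx y hy hxy => by
    rw [eq_of_mem_right hL hd hx, eq_of_mem_right hL hd hy]; gcongr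
  have hmono : MonotoneOn (twoSlopeLift L a b) (Icc b (b + 1)) := by
    have hba : b ≤ a := by linarith [h01.1]
    have hab : a ≤ b + 1 := by linarith [h01.2]
    rw [← Icc_union_Icc_eq_Icc hba hab]
    exact hleft.union_right hright (isGreatest_Icc hba) (isLeast_Icc hab)
  have hb1 : twoSlopeLift L a b (b + 1) = twoSlopeLift L a b b + 1 := by
    simpa using add_int (L := L) (a := a) (b := b) b 1
  intro x y hxy
  obtain ⟨s, hs, k, rfl⟩ := exists_eq_add_int b x
  obtain ⟨t, ht, m, rfl⟩ := exists_eq_add_int b y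
  rw [add_int, add_int]
  have hs' := Ico_subset_Icc_self hs
  have ht' := Ico_subset_Icc_self ht
  rcases lt_trichotomy k m with hkm | rfl | hkm
  · have h1 : (k : ℝ) + 1 ≤ m := by exact_mod_cast hkm
    have h2 := hmono hs' (right_mem_Icc.2 (by linarith)) hs'.2
    have h3 := hmono (left_mem_Icc.2 (by linarith)) ht' ht'.1
    linarith
  · linarith [hmono hs' ht' (by linarith)]
  · have h1 : (m : ℝ) + 1 ≤ k := by exact_mod_cast hkm
    linarith [hs.1, ht.2]

theorem left_break (hL : 1 < L) (hd : a - b = L * (1 - (a - b))) :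
    twoSlopeLift L a b b = -b := by
  rw [eq_of_mem_left hL hd ⟨le_rfl, by linarith [(sub_mem_Ioo hL hd).1]⟩]; ring

theorem right_break (hL : 1 < L) (hd : a - b = L * (1 - (a - b))) :
    twoSlopeLift L a b a = 1 - a := by
  rw [eq_of_mem_right hL hd ⟨le_rfl, by linarith [(sub_mem_Ioo hL hd).2]⟩]; ring

/-- The map `x ↦ -F x` is an involution. -/
theorem apply_neg_apply (hL : 1 < L) (hd : a - b = L * (1 - (a - b))) (x : ℝ) :
    twoSlopeLift L a b (-twoSlopeLift L a b x) = -x := by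
  have hi := inv_mul_sub hL hd
  have hL0 : 0 < L := by linarith
  have hLi : 0 < L⁻¹ := by positivity
  have hLL : L * L⁻¹ = 1 := mul_inv_cancel₀ hL0.ne'
  obtain ⟨t, ht, k, rfl⟩ := exists_eq_add_int b x
  rw [add_int]
  rcases le_total t a with hta | hta
  · rw [eq_of_mem_left hL hd ⟨ht.1, hta⟩]
    have h1 : 0 ≤ L⁻¹ * (t - b) := mul_nonneg hLi.le (by linarith [ht.1])
    have h2 : L⁻¹ * (t - b) ≤ L⁻¹ * (a - b) := by gcongr
    have h3 : -(-b + L⁻¹ * (t - b) + k) = (b - L⁻¹ * (t - b) + 1) + ((-k - 1 : ℤ) : ℝ) := by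
      push_cast; ring
    rw [h3, add_int, eq_of_mem_right hL hd ⟨by linarith, by linarith⟩]
    push_cast
    linear_combination (b - t) * hLL - hd
  · rw [eq_of_mem_right hL hd ⟨hta, ht.2.le⟩]
    have h1 : 0 ≤ L * (t - a) := mul_nonneg hL0.le (by linarith)
    have h2 : L * (t - a) ≤ L * (1 - (a - b)) :=
      mul_le_mul_of_nonneg_left (by linarith [ht.2]) hL0.le
    have h3 : -(1 - a + L * (t - a) + k) = (a - L * (t - a)) + ((-k - 1 : ℤ) : ℝ) := by
      push_cast; ring
    rw [h3, add_int, eq_of_mem_left hL hd ⟨by linarith, by linarith⟩]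
    push_cast
    linear_combination (a - t) * hLL + hi

/-- The lift as a bundled degree-one monotone circle map. -/
noncomputable def toCircleDeg1Lift (hL : 1 < L) (hd : a - b = L * (1 - (a - b))) :
    CircleDeg1Lift where
  toFun := twoSlopeLift L a b
  monotone' := monotone hL hd
  map_add_one' x := by simpa using add_int (L := L) (a := a) (b := b) x 1

theorem iterate_add_int (hL : 1 < L) (hd : a - b = L * (1 - (a - b))) (n : ℕ) (x : ℝ) (k : ℤ) :
    (twoSlopeLift L a b)^[n] (x + k) = (twoSlopeLift L a b)^[n] x + k := by
  have h := (toCircleDeg1Lift hL hd ^ n).map_add_int x k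
  rwa [CircleDeg1Lift.coe_pow] at h

theorem rotationNumber_eq (hL : 1 < L) (hd : a - b = L * (1 - (a - b))) :
    rotationNumber (twoSlopeLift L a b) =
      CircleDeg1Lift.translationNumber (toCircleDeg1Lift hL hd) := by
  refine Tendsto.limUnder_eq ?_
  have h := (toCircleDeg1Lift hL hd).tendsto_translationNumber 0
  simp only [CircleDeg1Lift.coe_pow, sub_zero] at h
  exact h

theorem iterate_neg_apply_iterate (hL : 1 < L) (hd : a - b = L * (1 - (a - b))) (n : ℕ) (x : ℝ) :
    (twoSlopeLift L a b)^[n] (-twoSlopeLift L a b ((twoSlopeLift L a b)^[n] x)) =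
      -twoSlopeLift L a b x := by
  induction n generalizing x with
  | zero => rfl
  | succ n ih =>
    rw [Function.iterate_succ_apply (twoSlopeLift L a b) n x, Function.iterate_succ_apply', ih,
      apply_neg_apply hL hd]

/-- If the rotation number has odd denominator, no orbit closes up after an even number of
steps with an odd translation. -/
theorem false_of_iterate_add_self_eq (hL : 1 < L) (hd : a - b = L * (1 - (a - b))) {p q : ℕ}
    (hodd : Odd q) (hrot : rotationNumber (twoSlopeLift L a b) = (p : ℝ) / q)
    {n : ℕ} (hn : n ≠ 0) {x : ℝ} {m : ℤ} (hm : Odd m)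
    (h : (twoSlopeLift L a b)^[n + n] x = x + m) : False := by
  have h1 := (toCircleDeg1Lift hL hd).translationNumber_of_map_pow_eq_add_int
    (x := x) (n := n + n) (m := m) (by rw [CircleDeg1Lift.coe_pow]; exact h) (by omega)
  rw [← rotationNumber_eq, hrot] at h1
  have hq : (q : ℝ) ≠ 0 := by exact_mod_cast hodd.pos.ne'
  have hn' : ((n + n : ℕ) : ℝ) ≠ 0 := by exact_mod_cast (by omega : n + n ≠ 0)
  rw [div_eq_div_iff hq hn'] at h1
  have h2 : (p : ℤ) * ((n + n : ℕ) : ℤ) = m * q := by exact_mod_cast h1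
  have h3 : Odd ((p : ℤ) * ((n + n : ℕ) : ℤ)) := h2 ▸ hm.mul ((Int.odd_coe_nat q).2 hodd)
  have h4 : Even ((p : ℤ) * ((n + n : ℕ) : ℤ)) := Even.mul_left ⟨(n : ℤ), Nat.cast_add n n⟩ _
  exact Int.not_even_iff_odd.2 h3 h4

theorem iterate_break_ne (hL : 1 < L) (hd : a - b = L * (1 - (a - b))) {p q : ℕ}
    (hodd : Odd q) (hrot : rotationNumber (twoSlopeLift L a b) = (p : ℝ) / q) (n : ℕ) (k : ℤ) :
    (twoSlopeLift L a b)^[n] a ≠ b + k ∧ (twoSlopeLift L a b)^[n] b ≠ a + k := by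
  have h01 := sub_mem_Ioo hL hd
  rcases eq_or_ne n 0 with rfl | hn
  · simp only [Function.iterate_zero, id]
    constructor <;> intro h
    · have h1 : (0 : ℝ) < k := by linarith [h01.1]
      have h2 : (k : ℝ) < 1 := by linarith [h01.2]
      norm_cast at h1 h2
      omega
    · have h1 : (-1 : ℝ) < k := by linarith [h01.2]
      have h2 : (k : ℝ) < 0 := by linarith [h01.1]
      norm_cast at h1 h2
      omega
  constructor <;> intro h
  · have h1 := iterate_neg_apply_iterate hL hd n a
    rw [h, add_int, left_break hL hd, right_break hL hd,
      show -(-b + (k : ℝ)) = b + ((-k : ℤ) : ℝ) by push_cast; ring, iterate_add_int hL hd] at h1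
    refine false_of_iterate_add_self_eq hL hd hodd hrot hn (x := a) (m := 2 * k - 1)
      ⟨k - 1, by ring⟩ ?_
    rw [Function.iterate_add_apply, h, iterate_add_int hL hd]
    push_cast at h1 ⊢
    linear_combination h1
  · have h1 := iterate_neg_apply_iterate hL hd n b
    rw [h, add_int, left_break hL hd, right_break hL hd,
      show -(1 - a + (k : ℝ)) = a + ((-k - 1 : ℤ) : ℝ) by push_cast; ring,
      iterate_add_int hL hd] at h1
    refine false_of_iterate_add_self_eq hL hd hodd hrot hn (x := b) (m := 2 * k + 1)
      ⟨k, by ring⟩ ?_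
    rw [Function.iterate_add_apply, h, iterate_add_int hL hd]
    push_cast at h1 ⊢
    linear_combination h1

theorem exists_hasDerivWithinAt (hL : 1 < L) (hd : a - b = L * (1 - (a - b))) (x : ℝ) :
    ∃ m : ℤ, Odd m ∧ HasDerivWithinAt (twoSlopeLift L a b) (L ^ m) (Ici x) x := by
  obtain ⟨t, ht, k, rfl⟩ := exists_eq_add_int b x
  have key : ∀ s c e m : ℝ, t < e →
      (∀ y ∈ Icc t e, twoSlopeLift L a b y = c + m * (y - s)) →
      HasDerivWithinAt (twoSlopeLift L a b) m (Ici (t + k)) (t + k) := by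
    intro s c e m hte hy
    have haff : HasDerivWithinAt (fun y : ℝ => c + m * (y - k - s) + k) m (Ici (t + k)) (t + k) := by
      have := (((((hasDerivAt_id (t + k)).sub_const (k : ℝ)).sub_const s).const_mul m).const_add
        c).add_const (k : ℝ)
      simpa using this.hasDerivWithinAt
    have heq : ∀ y ∈ Icc (t + k) (e + k),
        twoSlopeLift L a b y = c + m * (y - k - s) + k := by
      intro y hyk
      have h := add_int (L := L) (a := a) (b := b) (y - k) k
      rw [sub_add_cancel] at h
      rw [h, hy (y - k) ⟨by linarith [hyk.1], by linarith [hyk.2]⟩]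
    refine haff.congr_of_eventuallyEq ?_ (heq _ ⟨le_rfl, by linarith⟩)
    filter_upwards [Icc_mem_nhdsGE (show t + (k : ℝ) < e + k by linarith)] with y hyk
    exact heq y hyk
  rcases lt_or_ge t a with hta | hta
  · refine ⟨-1, by decide, ?_⟩
    rw [zpow_neg_one]
    exact key b (-b) a _ hta fun y hy => eq_of_mem_left hL hd ⟨ht.1.trans hy.1, hy.2⟩
  · refine ⟨1, by decide, ?_⟩
    rw [zpow_one]
    exact key a (1 - a) (b + 1) _ ht.2 fun y hy => eq_of_mem_right hL hd ⟨hta.trans hy.1, hy.2⟩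

theorem exists_hasDerivWithinAt_iterate (hL : 1 < L) (hd : a - b = L * (1 - (a - b)))
    (n : ℕ) (x : ℝ) :
    ∃ m : ℤ, Even (m - n) ∧
      HasDerivWithinAt (twoSlopeLift L a b)^[n] (L ^ m) (Ici x) x := by
  induction n with
  | zero => exact ⟨0, by simp, by simpa using hasDerivWithinAt_id x (Ici x)⟩
  | succ n ih =>
    obtain ⟨m, hm, hder⟩ := ih
    obtain ⟨r, hr, hder'⟩ := exists_hasDerivWithinAt hL hd ((twoSlopeLift L a b)^[n] x)
    refine ⟨r + m, ?_, ?_⟩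
    · have h := (hr.sub_odd odd_one).add hm
      rwa [show r - 1 + (m - n) = r + m - ((n + 1 : ℕ) : ℤ) by push_cast; ring] at h
    · rw [Function.iterate_succ', zpow_add₀ (by positivity)]
      exact hder'.comp x hder fun y hy => (monotone hL hd).iterate n hy

theorem not_exists_iterate_eq_add (hL : 1 < L) (hd : a - b = L * (1 - (a - b))) {q : ℕ}
    (hodd : Odd q) (c : ℝ) :
    ¬ ∃ u v : ℝ, u < v ∧ ∀ x ∈ Icc u v, (twoSlopeLift L a b)^[q] x = x + c := by
  rintro ⟨u, v, huv, h⟩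
  obtain ⟨m, hm, hder⟩ := exists_hasDerivWithinAt_iterate hL hd q u
  have h1 : HasDerivWithinAt (twoSlopeLift L a b)^[q] 1 (Ici u) u := by
    refine ((hasDerivWithinAt_id u (Ici u)).add_const c).congr_of_eventuallyEq ?_
      (h u ⟨le_rfl, huv.le⟩)
    filter_upwards [Icc_mem_nhdsGE huv] with y hy
    exact h y hy
  have h2 : L ^ m = 1 := (uniqueDiffWithinAt_Ici u).eq_deriv _ hder h1
  obtain rfl : m = 0 := (zpow_eq_one_iff_right₀ (by linarith) hL.ne').1 h2
  rw [zero_sub, even_neg] at hm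
  exact Int.not_even_iff_odd.2 ((Int.odd_coe_nat q).2 hodd) hm

end twoSlopeLift

theorem Ftrap_eq_twoSlopeLift (ℓ α θ : ℝ) :
    Ftrap ℓ α θ = twoSlopeLift (Lam α θ) (brk0 ℓ θ) (brk1 ℓ α θ) := rfl

theorem Lam_eq_tan {α θ : ℝ} (hα : 0 < cos α) (hθ : 0 < cos θ) :
    Lam α θ = (tan θ + tan α) / (tan θ - tan α) := by
  have h1 : sin (θ + α) = cos θ * cos α * (tan θ + tan α) := by
    rw [sin_add, tan_eq_sin_div_cos, tan_eq_sin_div_cos]; field_simp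
  have h2 : sin (θ - α) = cos θ * cos α * (tan θ - tan α) := by
    rw [sin_sub, tan_eq_sin_div_cos, tan_eq_sin_div_cos]; field_simp
  rw [Lam, h1, h2, mul_div_mul_left _ _ (by positivity)]

/-- if ρ(F_{ℓ,α,θ}) = p/q with q odd (in lowest terms), then
F^[q] = · + p on no nondegenerate interval, and the break points a₀ and a₁
are not on the same orbit of the circle map. -/
theorem stmt5 (ℓ α θ : ℝ) (hℓ : 0 < ℓ) (hα : 0 < α) (hαθ : α < θ)
    (hθ : θ < π / 2) (htan : Real.tan θ > 2 * ℓ + Real.tan α)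
    (p q : ℕ) (hq : 0 < q) (hodd : Odd q) (hpq : Nat.Coprime p q)
    (hrot : rotationNumber (Ftrap ℓ α θ) = (p : ℝ) / (q : ℝ)) :
    (¬ ∃ a b : ℝ, a < b ∧ ∀ x ∈ Set.Icc a b, (Ftrap ℓ α θ)^[q] x = x + (p : ℝ)) ∧
    (∀ (n : ℕ) (k : ℤ),
      (Ftrap ℓ α θ)^[n] (brk0 ℓ θ) ≠ brk1 ℓ α θ + (k : ℝ) ∧
      (Ftrap ℓ α θ)^[n] (brk1 ℓ α θ) ≠ brk0 ℓ θ + (k : ℝ)) := by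
  have hcα : 0 < cos α := cos_pos_of_mem_Ioo ⟨by linarith, by linarith⟩
  have hcθ : 0 < cos θ := cos_pos_of_mem_Ioo ⟨by linarith, by linarith⟩
  have htα : 0 < tan α := tan_pos_of_pos_of_lt_pi_div_two hα (by linarith)
  have htθ : 0 < tan θ := by linarith
  have hsub : 0 < tan θ - tan α := by linarith
  have hL : 1 < Lam α θ := by
    rw [Lam_eq_tan hcα hcθ, one_lt_div hsub]; linarith
  have hd : brk0 ℓ θ - brk1 ℓ α θ = Lam α θ * (1 - (brk0 ℓ θ - brk1 ℓ α θ)) := by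
    rw [Lam_eq_tan hcα hcθ, brk0, brk1]
    field_simp
    ring
  rw [Ftrap_eq_twoSlopeLift] at hrot ⊢
  exact ⟨twoSlopeLift.not_exists_iterate_eq_add hL hd hodd p,
    twoSlopeLift.iterate_break_ne hL hd hodd hrot⟩
end

section
/- Fix ℓ > 0 and α ∈ (0, π/2), and let r ∈ [0,1) be either irrational or of the form p/q with gcd(p,q) = 1 and q EVEN. If θ* ∈ (arctan(2ℓ + tan α), π/2) satisfies ρ(F_{ℓ,α,θ*}) = r, then: (a) θ* is the unique parameter in (arctan(2ℓ + tan α), π/2) whose rotation number equals r; and (b) the circle map at θ* is topologically conjugate to the rotation by r, i.e., there exists a continuous strictly increasing H : ℝ → ℝ with H(x+1) = H(x)+1 and H(F_{ℓ,α,θ*}(x)) = H(x) + r for all x ∈ ℝ. -/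
open Real Filter Set

open scoped Topology

/-- A lift of a circle homeomorphism which is affine with slope `L⁻¹` on `[a, b]` and with slope
`L` on `[b, a + 1]`, with `F a = -a` and `F b = 1 - b`. -/
structure IsTwoSlopeLift (F : ℝ → ℝ) (a b L : ℝ) : Prop where
  one_lt : 1 < L
  lt : a < b
  slope_eq : L * (a + 1 - b) = b - a
  map_add_one : ∀ x, F (x + 1) = F x + 1
  map_left : ∀ x, a ≤ x → x ≤ b → F x = -a + L⁻¹ * (x - a)
  map_right : ∀ x, b ≤ x → x ≤ a + 1 → F x = 1 - b + L * (x - b)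

namespace IsTwoSlopeLift

variable {F : ℝ → ℝ} {a b L : ℝ}

lemma pos (hF : IsTwoSlopeLift F a b L) : 0 < L := one_pos.trans hF.one_lt

lemma inv_pos (hF : IsTwoSlopeLift F a b L) : 0 < L⁻¹ := _root_.inv_pos.2 hF.pos

lemma lt_add_one (hF : IsTwoSlopeLift F a b L) : b < a + 1 := by
  have := hF.slope_eq
  have := hF.lt
  have := hF.pos
  by_contra! h
  nlinarith

lemma inv_slope_eq (hF : IsTwoSlopeLift F a b L) : L⁻¹ * (b - a) = a + 1 - b := by
  rw [← hF.slope_eq, inv_mul_cancel_left₀ hF.pos.ne']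

lemma map_a (hF : IsTwoSlopeLift F a b L) : F a = -a := by
  simp [hF.map_left a le_rfl hF.lt.le]

lemma map_b (hF : IsTwoSlopeLift F a b L) : F b = 1 - b := by
  simp [hF.map_right b le_rfl hF.lt_add_one.le]

lemma map_sub_one (hF : IsTwoSlopeLift F a b L) (x : ℝ) : F (x - 1) = F x - 1 := by
  have := hF.map_add_one (x - 1)
  rw [sub_add_cancel] at this
  linarith

lemma map_add_int (hF : IsTwoSlopeLift F a b L) (x : ℝ) (n : ℤ) : F (x + n) = F x + n := by
  induction n using Int.induction_on with
  | zero => simp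
  | succ n ih =>
    push_cast at ih ⊢
    rw [← add_assoc, hF.map_add_one, ih, add_assoc]
  | pred n ih =>
    push_cast at ih ⊢
    rw [← add_sub_assoc, hF.map_sub_one, ih, add_sub_assoc]

lemma map_sub_int (hF : IsTwoSlopeLift F a b L) (x : ℝ) (n : ℤ) : F (x - n) = F x - n := by
  simpa [sub_eq_add_neg] using hF.map_add_int x (-n)

lemma lt_map_of_mem_Icc (hF : IsTwoSlopeLift F a b L) {x y : ℝ} (hx : a ≤ x) (hxy : x < y)
    (hy : y ≤ a + 1) : F x < F y := by
  have h1 := hF.inv_pos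
  have h2 := hF.pos
  have hl : ∀ u v, a ≤ u → u < v → v ≤ b → F u < F v := fun u v hu huv hv => by
    rw [hF.map_left u hu (huv.le.trans hv), hF.map_left v (hu.trans huv.le) hv]
    nlinarith
  have hr : ∀ u v, b ≤ u → u < v → v ≤ a + 1 → F u < F v := fun u v hu huv hv => by
    rw [hF.map_right u hu (huv.le.trans hv), hF.map_right v (hu.trans huv.le) hv]
    nlinarith
  rcases le_or_gt y b with hyb | hyb
  · exact hl x y hx hxy hyb
  · rcases lt_or_ge x b with hxb | hxb
    · exact (hl x b hx hxb le_rfl).trans (hr b y le_rfl hyb hy)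
    · exact hr x y hxb hxy hy

lemma strictMono (hF : IsTwoSlopeLift F a b L) : StrictMono F := by
  have hle : ∀ z : ℝ, a ≤ z - ⌊z - a⌋ ∧ z - ⌊z - a⌋ < a + 1 := fun z =>
    ⟨by linarith [Int.floor_le (z - a)], by linarith [Int.lt_floor_add_one (z - a)]⟩
  intro x y hxy
  obtain ⟨hx1, hx2⟩ := hle x
  obtain ⟨hy1, hy2⟩ := hle y
  rcases (Int.floor_mono (sub_le_sub_right hxy.le a)).eq_or_lt with h | h
  · rw [← h] at hy1 hy2
    have := hF.lt_map_of_mem_Icc hx1 (sub_lt_sub_right hxy (⌊x - a⌋ : ℝ)) hy2.le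
    rw [hF.map_sub_int, hF.map_sub_int] at this
    linarith
  · have h3 := hF.lt_map_of_mem_Icc hx1 hx2 le_rfl
    have h4 : F a ≤ F (y - ⌊y - a⌋) := by
      rcases hy1.eq_or_lt with h0 | h0
      · rw [← h0]
      · exact (hF.lt_map_of_mem_Icc le_rfl h0 hy2.le).le
    rw [hF.map_sub_int] at h3 h4
    rw [hF.map_add_one] at h3
    have h5 : (⌊x - a⌋ : ℝ) + 1 ≤ ⌊y - a⌋ := by exact_mod_cast h
    linarith

lemma map_neg_map (hF : IsTwoSlopeLift F a b L) (x : ℝ) : F (-F x) = -x := by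
  have key : ∀ x, a ≤ x → x ≤ a + 1 → F (-F x) = -x := by
    intro x hx hx'
    have h1 := hF.inv_pos
    have h2 := hF.pos
    have h3 := hF.slope_eq
    have h4 := hF.inv_slope_eq
    have h5 : L * L⁻¹ = 1 := mul_inv_cancel₀ h2.ne'
    rcases le_total x b with h | h
    · have hm := hF.map_sub_one (-F x + 1)
      rw [add_sub_cancel_right] at hm
      rw [hm, hF.map_left x hx h, hF.map_right _ (by nlinarith) (by nlinarith)]
      linear_combination h3 + (a - x) * h5
    · have hm := hF.map_sub_one (-F x + 1)
      rw [add_sub_cancel_right] at hm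
      rw [hm, hF.map_right x h hx', hF.map_left _ (by nlinarith) (by nlinarith)]
      linear_combination h4 + (b - x) * h5
  have := key (x - ⌊x - a⌋) (by linarith [Int.floor_le (x - a)])
    (by linarith [Int.lt_floor_add_one (x - a)])
  rw [hF.map_sub_int, show -(F x - (⌊x - a⌋ : ℝ)) = -F x + ⌊x - a⌋ by ring,
    hF.map_add_int] at this
  linarith

lemma surjective (hF : IsTwoSlopeLift F a b L) : Function.Surjective F := fun x =>
  ⟨-F (-x), by rw [hF.map_neg_map, neg_neg]⟩

lemma continuous (hF : IsTwoSlopeLift F a b L) : Continuous F :=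
  hF.strictMono.monotone.continuous_of_surjective hF.surjective

/-- The bundled version of the lift. -/
def toCircleDeg1Lift (hF : IsTwoSlopeLift F a b L) : CircleDeg1Lift :=
  ⟨⟨F, hF.strictMono.monotone⟩, hF.map_add_one⟩

@[simp]
lemma coe_toCircleDeg1Lift (hF : IsTwoSlopeLift F a b L) : ⇑hF.toCircleDeg1Lift = F := rfl

lemma rotationNumber_eq (hF : IsTwoSlopeLift F a b L) :
    rotationNumber F = hF.toCircleDeg1Lift.translationNumber := by
  have := hF.toCircleDeg1Lift.tendsto_translation_number₀
  simp only [CircleDeg1Lift.coe_pow, coe_toCircleDeg1Lift] at this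
  exact this.limUnder_eq

/-- If the vertices of the graph move up and to the left, then the lift increases strictly. -/
lemma lt_of_lt {F' : ℝ → ℝ} {a' b' L' : ℝ} (hF : IsTwoSlopeLift F a b L)
    (hF' : IsTwoSlopeLift F' a' b' L') (ha : a' < a) (hb : b' < b) (hab : a < b')
    (hba : b < a' + 1) (x : ℝ) : F x < F' x := by
  have key : ∀ x, a ≤ x → x ≤ a + 1 → F x < F' x := by
    intro x hx hx'
    have h1 := hF.inv_pos
    have h2 := hF'.inv_pos
    have h3 := hF.pos
    have h4 := hF'.pos
    have va : F a < F' a := by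
      have := hF'.strictMono ha
      rw [hF'.map_a] at this
      rw [hF.map_a]; linarith
    have vb : F b < F' b := by
      have := hF'.strictMono hb
      rw [hF'.map_b] at this
      rw [hF.map_b]; linarith
    have vb' : F b' < F' b' := by
      have := hF.strictMono hb
      rw [hF.map_b] at this
      rw [hF'.map_b]; linarith
    have va' : F (a' + 1) < F' (a' + 1) := by
      have := hF.strictMono ha
      rw [hF.map_a] at this
      rw [hF'.map_add_one, hF.map_add_one, hF'.map_a]; linarith
    have affine : ∀ m k u v : ℝ, 0 < m * u + k → 0 < m * v + k → u ≤ x → x ≤ v →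
        0 < m * x + k := by
      intro m k u v hu hv hux hxv
      rcases le_total 0 m with hm | hm <;> nlinarith
    rcases le_total x b' with h | h
    · rw [hF.map_left x hx (h.trans hb.le), hF'.map_left x (ha.le.trans hx) h]
      rw [hF.map_left a le_rfl hF.lt.le, hF'.map_left a ha.le hab.le] at va
      rw [hF.map_left b' hab.le hb.le, hF'.map_left b' hF'.lt.le le_rfl] at vb'
      have := affine (L'⁻¹ - L⁻¹) (-a' - L'⁻¹ * a' + a + L⁻¹ * a) a b'
        (by linarith) (by linarith) hx h
      linarith
    rcases le_total x b with h' | h'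
    · rw [hF.map_left x hx h', hF'.map_right x h (h'.trans hba.le)]
      rw [hF.map_left b hF.lt.le le_rfl, hF'.map_right b hb.le hba.le] at vb
      rw [hF.map_left b' hab.le hb.le, hF'.map_right b' le_rfl (hb.trans hba).le] at vb'
      have := affine (L' - L⁻¹) (1 - b' - L' * b' + a + L⁻¹ * a) b' b
        (by linarith) (by linarith) h h'
      linarith
    rcases le_total x (a' + 1) with h'' | h''
    · rw [hF.map_right x h' hx', hF'.map_right x h h'']
      rw [hF.map_right b le_rfl hF.lt_add_one.le, hF'.map_right b hb.le hba.le] at vb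
      rw [hF.map_right (a' + 1) hba.le (by linarith),
        hF'.map_right (a' + 1) (hb.trans hba).le le_rfl] at va'
      have := affine (L' - L) (1 - b' - L' * b' - 1 + b + L * b) b (a' + 1)
        (by linarith) (by linarith) h' h''
      linarith
    · have e1 := hF.strictMono.monotone hx'
      have e2 := hF'.strictMono.monotone h''
      rw [hF.map_add_one, hF.map_a] at e1
      rw [hF'.map_add_one, hF'.map_a] at e2
      linarith
  have := key (x - ⌊x - a⌋) (by linarith [Int.floor_le (x - a)])
    (by linarith [Int.lt_floor_add_one (x - a)])
  rw [hF.map_sub_int, hF'.map_sub_int] at this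
  linarith

end IsTwoSlopeLift

/-- Shifting the window of summation of a sequence that is periodic up to translation. -/
lemma sum_range_add_of_add_eq {D : ℕ → ℤ} {p : ℤ} {q : ℕ} (hD : ∀ i, D (i + q) = D i + p) (j : ℕ) :
    ∑ i ∈ Finset.range q, D (i + j) = ∑ i ∈ Finset.range q, D i + j * p := by
  induction j with
  | zero => simp
  | succ j ih =>
    have h1 := Finset.sum_range_succ (fun i => D (i + j)) q
    have h2 := Finset.sum_range_succ' (fun i => D (i + j)) q
    rw [h1, ih, add_comm q j, hD] at h2
    have h3 : ∑ i ∈ Finset.range q, D (i + 1 + j) = ∑ i ∈ Finset.range q, D (i + (j + 1)) :=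
      Finset.sum_congr rfl fun i _ => by rw [add_right_comm, add_assoc]
    rw [h3, zero_add] at h2
    push_cast
    linarith

lemma sum_floor_add_inv {p : ℤ} {q : ℕ} (hq : 0 < q) (hpq : IsCoprime p (q : ℤ)) (x : ℝ) :
    ∑ i ∈ Finset.range q, ⌊x + 1 / q + i * (p / q : ℝ)⌋ =
      ∑ i ∈ Finset.range q, ⌊x + i * (p / q : ℝ)⌋ + 1 := by
  have hq0 : (q : ℝ) ≠ 0 := by positivity
  obtain ⟨u, v, huv⟩ := hpq
  obtain ⟨j, m, hjm⟩ : ∃ (j : ℕ) (m : ℤ), j * p = 1 + m * q := by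
    have h0 : 0 ≤ u + q * |u| := by
      have : (1 : ℤ) ≤ q := by exact_mod_cast hq
      nlinarith [neg_abs_le u, abs_nonneg u]
    refine ⟨(u + q * |u|).toNat, |u| * p - v, ?_⟩
    rw [Int.toNat_of_nonneg h0]
    linear_combination huv
  have hD : ∀ i : ℕ, ⌊x + (i + q : ℕ) * (p / q : ℝ)⌋ = ⌊x + i * (p / q : ℝ)⌋ + p := by
    intro i
    rw [← Int.floor_add_intCast]
    congr 1
    push_cast
    field_simp
    ring
  have hs := sum_range_add_of_add_eq (D := fun i : ℕ => ⌊x + i * (p / q : ℝ)⌋) hD j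
  have hm : (j : ℝ) * p = 1 + m * q := by exact_mod_cast hjm
  have : ∀ i : ℕ, ⌊x + 1 / q + i * (p / q : ℝ)⌋ = ⌊x + (i + j : ℕ) * (p / q : ℝ)⌋ - m := by
    intro i
    rw [← Int.floor_sub_intCast]
    congr 1
    push_cast
    field_simp
    linear_combination -hm
  simp only [this, Finset.sum_sub_distrib, hs, hjm]
  simp
  ring

lemma sum_floor_add_nat_div {p : ℤ} {q : ℕ} (hq : 0 < q) (hpq : IsCoprime p (q : ℤ)) (x : ℝ)
    (k : ℕ) :
    ∑ i ∈ Finset.range q, ⌊x + k / q + i * (p / q : ℝ)⌋ =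
      ∑ i ∈ Finset.range q, ⌊x + i * (p / q : ℝ)⌋ + k := by
  induction k with
  | zero => simp
  | succ k ih =>
    push_cast
    rw [← add_assoc, ← ih, ← sum_floor_add_inv hq hpq]
    refine Finset.sum_congr rfl fun i _ => ?_
    congr 1
    ring

/-- A Denjoy-Koksma type bound: along denominators of good approximations of an irrational
rotation, half of the visits are to any given half circle, up to a bounded error. -/
lemma exists_le_sum_floor {r : ℝ} (hr : Irrational r) (z : ℝ) (N : ℕ) :
    ∃ n ≥ N, -5 ≤ ∑ i ∈ Finset.range n, (1 - 2 * (⌊z + i * r⌋ - ⌊z + i * r - 1 / 2⌋)) := by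
  obtain ⟨ε, hε, hε0⟩ := (((hr.eventually_forall_le_dist_cast_rat_of_den_le N).filter_mono
    (nhdsWithin_le_nhds (s := Ioi (0 : ℝ)))).and self_mem_nhdsWithin).exists
  obtain ⟨n, hn⟩ := exists_nat_gt (1 / ε)
  have hε0 : 0 < ε := hε0
  have hn0 : (0 : ℝ) < n := (by positivity : 0 < 1 / ε).trans hn
  obtain ⟨s, hs1, hs2⟩ := Real.exists_rat_abs_sub_le_and_den_le r (n := n) (by exact_mod_cast hn0)
  set p := s.num with hp
  set q := s.den with hqd
  have hq : 0 < q := s.den_pos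
  have hq' : (0 : ℝ) < q := by exact_mod_cast hq
  have hq1 : (1 : ℝ) ≤ q := by exact_mod_cast hq
  have hs : (s : ℝ) = p / q := Rat.cast_def s
  have hpq : IsCoprime p (q : ℤ) := Rat.isCoprime_num_den s
  have hqn : (q : ℝ) ≤ n := by exact_mod_cast hs2
  have hqN : N < q := by
    by_contra! hle
    have h1 := hε s hle
    rw [Real.dist_eq] at h1
    have h2 : 1 / (((n : ℝ) + 1) * q) < ε := by
      rw [div_lt_iff₀ hε0] at hn
      rw [div_lt_iff₀ (by positivity)]
      nlinarith
    linarith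
  have hclose : |r - p / q| * q ≤ 1 / q := by
    rw [← hs]
    calc |r - s| * q ≤ 1 / (((n : ℝ) + 1) * q) * q := by gcongr
      _ = 1 / ((n : ℝ) + 1) := by field_simp
      _ ≤ 1 / q := by gcongr; linarith
  have hi : ∀ i ∈ Finset.range q, |(i : ℝ) * r - i * (p / q)| ≤ 1 / q := by
    intro i hi
    have : (i : ℝ) ≤ q := by exact_mod_cast (Finset.mem_range.1 hi).le
    rw [← mul_sub, abs_mul, abs_of_nonneg (Nat.cast_nonneg i), mul_comm]
    exact (mul_le_mul_of_nonneg_left this (abs_nonneg _)).trans hclose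
  set B : ℝ → ℤ := fun x => ∑ i ∈ Finset.range q, ⌊x + i * (p / q : ℝ)⌋ with hB
  set A : ℝ → ℤ := fun x => ∑ i ∈ Finset.range q, ⌊x + i * r⌋ with hA
  have hB1 : ∀ x (k : ℕ), B (x + k / q) = B x + k := fun x k => sum_floor_add_nat_div hq hpq x k
  have hBmono : Monotone B := fun x y hxy => Finset.sum_le_sum fun i _ => by gcongr
  have hAB : ∀ x, A x ≤ B x + 1 := by
    intro x
    have h1 := hB1 x 1
    push_cast at h1
    rw [← h1]
    refine Finset.sum_le_sum fun i h => Int.floor_mono ?_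
    linarith [(abs_le.1 (hi i h)).2]
  have hBA : ∀ x, B x - 1 ≤ A x := by
    intro x
    have h1 := hB1 (x - 1 / q) 1
    push_cast at h1
    rw [sub_add_cancel] at h1
    rw [h1, add_sub_cancel_right]
    refine Finset.sum_le_sum fun i h => Int.floor_mono ?_
    linarith [(abs_le.1 (hi i h)).1]
  have hhalf : 2 * (B z - B (z - 1 / 2)) ≤ q + 1 := by
    have h1 := hB1 (z - 1 / 2) ((q + 1) / 2)
    have h2 : z ≤ z - 1 / 2 + ((q + 1) / 2 : ℕ) / q := by
      have h3 : (q : ℝ) ≤ 2 * ((q + 1) / 2 : ℕ) := by exact_mod_cast (by omega)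
      have : (1 : ℝ) / 2 ≤ ((q + 1) / 2 : ℕ) / q := by
        rw [le_div_iff₀ hq']
        linarith
      linarith
    have h3 := hBmono h2
    omega
  refine ⟨q, hqN.le, ?_⟩
  have hsum : ∑ i ∈ Finset.range q, (1 - 2 * (⌊z + i * r⌋ - ⌊z + i * r - 1 / 2⌋)) =
      q - 2 * (A z - A (z - 1 / 2)) := by
    simp only [hA, Finset.sum_sub_distrib, ← Finset.mul_sum, sub_add_eq_add_sub]
    simp
  rw [hsum]
  have := hAB z
  have := hBA (z - 1 / 2)
  omega

namespace IsTwoSlopeLift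

variable {F : ℝ → ℝ} {a b L : ℝ}

lemma iterate_add_int (hF : IsTwoSlopeLift F a b L) (n : ℕ) (x : ℝ) (m : ℤ) :
    F^[n] (x + m) = F^[n] x + m := by
  rw [← hF.coe_toCircleDeg1Lift, ← CircleDeg1Lift.coe_pow, CircleDeg1Lift.map_add_int]

lemma iterate_neg_iterate (hF : IsTwoSlopeLift F a b L) (n : ℕ) (x : ℝ) :
    F^[n] (-F^[n] x) = -x := by
  induction n generalizing x with
  | zero => simp
  | succ n ih => rw [Function.iterate_succ_apply' F n x, Function.iterate_succ_apply,
      hF.map_neg_map, ih]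

lemma neg_map_le_self_iff (hF : IsTwoSlopeLift F a b L) (x : ℝ) : -F x ≤ x ↔ a ≤ x := by
  constructor
  · intro h
    by_contra! hx
    have := hF.strictMono hx
    rw [hF.map_a] at this
    linarith
  · intro h
    have := hF.strictMono.monotone h
    rw [hF.map_a] at this
    linarith

lemma neg_map_add_one_le_self_iff (hF : IsTwoSlopeLift F a b L) (x : ℝ) :
    -F x + 1 ≤ x ↔ b ≤ x := by
  constructor
  · intro h
    by_contra! hx
    have := hF.strictMono hx
    rw [hF.map_b] at this
    linarith
  · intro h
    have := hF.strictMono.monotone h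
    rw [hF.map_b] at this
    linarith

/-- The lift is affine to the right of every point, with slope a power of `L`. -/
lemma eventually_map_eq (hF : IsTwoSlopeLift F a b L) (x : ℝ) :
    ∀ᶠ y in 𝓝[≥] x, F y = F x + L ^ (1 - 2 * (⌊x - a⌋ - ⌊x - b⌋)) * (y - x) := by
  have hba := hF.lt_add_one
  have hab := hF.lt
  set n := ⌊x - a⌋ with hn
  have h1 : (n : ℝ) ≤ x - a := Int.floor_le _
  have h2 : x - a < n + 1 := Int.lt_floor_add_one _
  have hFn : ∀ y, F y = F (y - n) + n := fun y => by rw [hF.map_sub_int]; ring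
  rcases lt_or_ge (x - n) b with h | h
  · have hfl : ⌊x - b⌋ = n - 1 := by
      rw [Int.floor_eq_iff]; push_cast; constructor <;> linarith
    filter_upwards [Ico_mem_nhdsGE (show x < b + n by linarith)] with y hy
    rw [hfl, hFn y, hFn x, hF.map_left (x - n) (by linarith) h.le,
      hF.map_left (y - n) (by linarith [hy.1]) (by linarith [hy.2]),
      show 1 - 2 * (n - (n - 1)) = (-1 : ℤ) by ring, zpow_neg_one]
    ring
  · have hfl : ⌊x - b⌋ = n := by
      rw [Int.floor_eq_iff]; constructor <;> linarith
    filter_upwards [Ico_mem_nhdsGE (show x < a + 1 + n by linarith)] with y hy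
    rw [hfl, hFn y, hFn x, hF.map_right (x - n) h (by linarith),
      hF.map_right (y - n) (by linarith [hy.1]) (by linarith [hy.2])]
    simp only [sub_self, mul_zero, sub_zero, zpow_one]
    ring

lemma eventually_iterate_eq (hF : IsTwoSlopeLift F a b L) (x : ℝ) (n : ℕ) :
    ∀ᶠ y in 𝓝[≥] x, F^[n] y = F^[n] x +
      L ^ (∑ i ∈ Finset.range n, (1 - 2 * (⌊F^[i] x - a⌋ - ⌊F^[i] x - b⌋))) * (y - x) := by
  induction n with
  | zero => simp
  | succ n ih =>
    have ht : Tendsto F^[n] (𝓝[≥] x) (𝓝[≥] (F^[n] x)) := by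
      refine tendsto_nhdsWithin_iff.2 ⟨?_, ?_⟩
      · exact ((hF.continuous.iterate n).tendsto x).mono_left nhdsWithin_le_nhds
      · filter_upwards [self_mem_nhdsWithin] with y hy
        exact hF.strictMono.monotone.iterate n hy
    filter_upwards [ih, ht.eventually (hF.eventually_map_eq (F^[n] x))] with y h1 h2
    rw [Function.iterate_succ_apply', Function.iterate_succ_apply', h2, Finset.sum_range_succ,
      add_comm (Finset.sum _ _), zpow_add₀ hF.pos.ne', h1]
    ring

/-- A half period exchanges the positions relative to the two break points. -/
lemma floor_iterate_sub_eq (hF : IsTwoSlopeLift F a b L) {k : ℕ} {j : ℤ} {x : ℝ}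
    (hx : F^[2 * k] x = x + (2 * j + 1 : ℤ)) : ⌊F^[k] x - b⌋ = ⌊x - a⌋ + j := by
  have hG : F^[k] (-F x) = (2 * j + 1 : ℤ) - F (F^[k] x) := by
    have h1 := hF.iterate_neg_iterate k (F (F^[k] x))
    have h2 : F^[k] (F (F^[k] x)) = F x + (2 * j + 1 : ℤ) := by
      rw [← Function.iterate_succ_apply' F k x, ← Function.iterate_add_apply,
        show k + (k + 1) = 1 + 2 * k by ring, Function.iterate_add_apply, hx,
        Function.iterate_one, hF.map_add_int]
    rw [h2, neg_add, ← Int.cast_neg, hF.iterate_add_int] at h1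
    push_cast at h1 ⊢
    linarith
  refine eq_of_forall_le_iff fun n => ?_
  have hmono := (hF.strictMono.iterate k).le_iff_le (a := -F x + (2 * (n - j) : ℤ)) (b := x)
  rw [hF.iterate_add_int, hG] at hmono
  rw [← sub_le_iff_le_add, Int.le_floor, Int.le_floor, le_sub_comm (a := (n : ℝ)),
    le_sub_comm (c := a), ← hF.neg_map_add_one_le_self_iff, ← hF.neg_map_le_self_iff, hF.map_sub_int, hF.map_sub_int]
  push_cast at hmono ⊢
  constructor
  · intro h
    have := hmono.1 (by linarith)
    linarith
  · intro h
    have := hmono.2 (by linarith)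
    linarith

lemma sum_floor_eq_zero (hF : IsTwoSlopeLift F a b L) {k : ℕ} {j : ℤ} {x : ℝ}
    (hx : F^[2 * k] x = x + (2 * j + 1 : ℤ)) :
    ∑ i ∈ Finset.range (2 * k), (1 - 2 * (⌊F^[i] x - a⌋ - ⌊F^[i] x - b⌋)) = 0 := by
  have hper : ∀ i, F^[i + 2 * k] x = F^[i] x + (2 * j + 1 : ℤ) := fun i => by
    rw [Function.iterate_add_apply, hx, hF.iterate_add_int]
  have hs := sum_range_add_of_add_eq (D := fun i => ⌊F^[i] x - b⌋) (p := 2 * j + 1) (q := 2 * k)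
    (fun i => by
      rw [hper, ← Int.floor_add_intCast]
      congr 1
      ring) k
  have hk : ∀ i, ⌊F^[i + k] x - b⌋ = ⌊F^[i] x - a⌋ + j := fun i => by
    rw [add_comm i k, Function.iterate_add_apply]
    refine hF.floor_iterate_sub_eq ?_
    rw [← Function.iterate_add_apply, add_comm, hper]
  simp only [hk, Finset.sum_add_distrib] at hs
  simp only [Finset.sum_sub_distrib, ← Finset.mul_sum]
  simp at hs ⊢
  linarith

/-- For rotation numbers with even denominator the lift is periodic up to translation. -/
lemma iterate_eq_add (hF : IsTwoSlopeLift F a b L) {k : ℕ} {j : ℤ} {x₀ : ℝ}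
    (hx₀ : F^[2 * k] x₀ = x₀ + (2 * j + 1 : ℤ)) (x : ℝ) :
    F^[2 * k] x = x + (2 * j + 1 : ℤ) := by
  set s : Set ℝ := {x | F^[2 * k] x = x + (2 * j + 1 : ℤ)} with hs
  have hclosed : IsClosed s :=
    isClosed_eq (hF.continuous.iterate _) (continuous_id.add continuous_const)
  have hgt : ∀ y ∈ s, s ∈ 𝓝[>] y := by
    intro y hy
    have := (hF.eventually_iterate_eq y (2 * k)).filter_mono
      (nhdsWithin_mono y Ioi_subset_Ici_self)
    filter_upwards [this] with w hw
    rw [hF.sum_floor_eq_zero hy, zpow_zero, hy] at hw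
    change F^[2 * k] w = _
    rw [hw]
    ring
  obtain ⟨n, hn⟩ := exists_nat_ge (x₀ - x)
  have hsub := (hclosed.inter isClosed_Icc).Icc_subset_of_forall_mem_nhdsWithin (a := x₀)
    (b := x + n) hx₀ fun y hy => hgt y hy.1
  have hmem : F^[2 * k] (x + (n : ℤ)) = x + (n : ℤ) + (2 * j + 1 : ℤ) :=
    hsub ⟨by rw [Int.cast_natCast]; linarith, by simp⟩
  rw [hF.iterate_add_int] at hmem
  linarith

/-- A lift with a periodic iterate is conjugate to a translation. -/
lemma exists_conj_of_iterate_eq_add (hF : IsTwoSlopeLift F a b L) {q : ℕ} (hq : 0 < q) {p : ℤ}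
    (h : ∀ x, F^[q] x = x + p) :
    ∃ H : ℝ → ℝ, Continuous H ∧ StrictMono H ∧ (∀ x, H (x + 1) = H x + 1) ∧
      ∀ x, H (F x) = H x + p / q := by
  have hq' : (0 : ℝ) < q := by exact_mod_cast hq
  refine ⟨fun x => (∑ i ∈ Finset.range q, F^[i] x) / q, ?_, ?_, ?_, ?_⟩
  · exact (continuous_finsetSum _ fun i _ => hF.continuous.iterate i).div_const _
  · intro x y hxy
    refine div_lt_div_of_pos_right (Finset.sum_lt_sum_of_nonempty ?_ fun i _ =>
      hF.strictMono.iterate i hxy) hq'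
    exact Finset.nonempty_range_iff.2 hq.ne'
  · intro x
    have h1 : ∀ i, F^[i] (x + 1) = F^[i] x + 1 := fun i => by
      simpa using hF.iterate_add_int i x 1
    simp only [h1, Finset.sum_add_distrib]
    simp
    field_simp
  · intro x
    have h1 := Finset.sum_range_succ (fun i => F^[i] x) q
    have h2 := Finset.sum_range_succ' (fun i => F^[i] x) q
    rw [h1, h] at h2
    simp only [Function.iterate_succ_apply, Function.iterate_zero, id] at h2
    change (∑ i ∈ Finset.range q, F^[i] (F x)) / q = (∑ i ∈ Finset.range q, F^[i] x) / q + p / q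
    rw [← add_div]
    congr 1
    linarith

/-- An odd semiconjugacy to the translation by the rotation number. -/
lemma exists_odd_semiconj (hF : IsTwoSlopeLift F a b L) :
    ∃ h : ℝ → ℝ, Monotone h ∧ (∀ x, h (x + 1) = h x + 1) ∧ (∀ x, h (-x) = -h x) ∧
      ∀ x, h (F x) = h x + hF.toCircleDeg1Lift.translationNumber := by
  set τ := hF.toCircleDeg1Lift.translationNumber with hτ
  obtain ⟨g, hg⟩ := CircleDeg1Lift.semiconj_of_bijective_of_translationNumber_eq
    (f₁ := hF.toCircleDeg1Lift) (f₂ := CircleDeg1Lift.translate (Multiplicative.ofAdd τ))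
    ⟨hF.strictMono.injective, hF.surjective⟩ (CircleDeg1Lift.isUnit_iff_bijective.1 (Units.isUnit _))
    (by rw [CircleDeg1Lift.translationNumber_translate])
  have hg' : ∀ x, g (F x) = g x + τ := fun x => by
    have := hg x
    rw [CircleDeg1Lift.translate_apply, add_comm] at this
    exact this
  refine ⟨fun x => (g x - g (-x)) / 2, ?_, ?_, ?_, ?_⟩
  · intro x y hxy
    have h1 := g.monotone hxy
    have h2 := g.monotone (neg_le_neg hxy)
    change (g x - g (-x)) / 2 ≤ (g y - g (-y)) / 2
    linarith
  · intro x
    have h1 := g.map_sub_int (-x) 1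
    rw [Int.cast_one] at h1
    change (g (x + 1) - g (-(x + 1))) / 2 = (g x - g (-x)) / 2 + 1
    rw [neg_add', h1, g.map_add_one]
    ring
  · intro x
    change (g (-x) - g (- -x)) / 2 = -((g x - g (-x)) / 2)
    rw [neg_neg]
    ring
  · intro x
    have h1 := hg' (-F x)
    rw [hF.map_neg_map] at h1
    change (g (F x) - g (-F x)) / 2 = (g x - g (-x)) / 2 + τ
    rw [hg', h1]
    ring

section Irrational

variable {h : ℝ → ℝ} {r : ℝ}

lemma semiconj_iterate (hs : ∀ x, h (F x) = h x + r) (n : ℕ) (x : ℝ) :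
    h (F^[n] x) = h x + n * r := by
  induction n with
  | zero => simp
  | succ n ih =>
    rw [Function.iterate_succ_apply', hs, ih]
    push_cast
    ring

lemma semiconj_add_int (h1 : ∀ x, h (x + 1) = h x + 1) (x : ℝ) (n : ℤ) : h (x + n) = h x + n := by
  induction n using Int.induction_on with
  | zero => simp
  | succ n ih =>
    push_cast at ih ⊢
    rw [← add_assoc, h1, ih, add_assoc]
  | pred n ih =>
    push_cast at ih ⊢
    have := h1 (x + (-n - 1))
    rw [show x + (-(n : ℝ) - 1) + 1 = x + -n by ring] at this
    linarith

/-- On an interval where the semiconjugacy is constant, avoiding the break points, the lift is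
affine and its slope is determined by the semiconjugacy. -/
lemma map_sub_map_of_semiconj_eq (hF : IsTwoSlopeLift F a b L) (hm : Monotone h)
    (h1 : ∀ x, h (x + 1) = h x + 1) (hodd : ∀ x, h (-x) = -h x) (hs : ∀ x, h (F x) = h x + r)
    {x y z : ℝ} (hx : h x = z) (hy : h y = z) (hz : ∀ m : ℤ, 2 * z + r ≠ m) :
    F y - F x = L ^ (1 - 2 * (⌊z + r / 2⌋ - ⌊z + r / 2 - 1 / 2⌋)) * (y - x) := by
  have ha : h a = -(r / 2) := by
    have := hs a
    rw [hF.map_a, hodd] at this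
    linarith
  have hb : h b = 1 / 2 - r / 2 := by
    have h2 := hs b
    have h3 := h1 (-b)
    rw [hF.map_b, show 1 - b = -b + 1 by ring, h3, hodd] at h2
    linarith
  have hlt : ∀ {u v}, h u < h v → u < v := fun huv => hm.reflect_lt huv
  set n := ⌊z + r / 2⌋ with hn
  have hn1 : (n : ℝ) ≤ z + r / 2 := Int.floor_le _
  have hn2 : z + r / 2 < n + 1 := Int.lt_floor_add_one _
  have hn1' : (n : ℝ) < z + r / 2 := hn1.lt_of_ne fun he => hz (2 * n) (by push_cast; linarith)
  have hFn : ∀ y, F y = F (y - n) + n := fun y => by rw [hF.map_sub_int]; ring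
  have han := semiconj_add_int h1 a n
  have hbn := semiconj_add_int h1 b n
  have han' := semiconj_add_int h1 a (n + 1)
  push_cast at han'
  rcases lt_trichotomy (z + r / 2) (n + 1 / 2) with hc | hc | hc
  · have hfl : ⌊z + r / 2 - 1 / 2⌋ = n - 1 := by
      rw [Int.floor_eq_iff]; push_cast; constructor <;> linarith
    have hbd : ∀ w, h w = z → a ≤ w - n ∧ w - n ≤ b := fun w hw => by
      have e1 : a + n < w := hlt (by linarith)
      have e2 : w < b + n := hlt (by linarith)
      constructor <;> linarith
    rw [hfl, hFn y, hFn x, hF.map_left _ (hbd x hx).1 (hbd x hx).2,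
      hF.map_left _ (hbd y hy).1 (hbd y hy).2, show 1 - 2 * (n - (n - 1)) = (-1 : ℤ) by ring,
      zpow_neg_one]
    ring
  · exact absurd (by push_cast; linarith) (hz (2 * n + 1))
  · have hfl : ⌊z + r / 2 - 1 / 2⌋ = n := by
      rw [Int.floor_eq_iff]; constructor <;> linarith
    have hbd : ∀ w, h w = z → b ≤ w - n ∧ w - n ≤ a + 1 := fun w hw => by
      have e1 : b + n < w := hlt (by linarith)
      have e2 : w < a + (n + 1) := hlt (by linarith)
      constructor <;> linarith
    rw [hfl, hFn y, hFn x, hF.map_right _ (hbd x hx).1 (hbd x hx).2,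
      hF.map_right _ (hbd y hy).1 (hbd y hy).2]
    simp only [sub_self, mul_zero, sub_zero, zpow_one]
    ring

lemma iterate_sub_iterate_of_semiconj_eq (hF : IsTwoSlopeLift F a b L) (hm : Monotone h)
    (h1 : ∀ x, h (x + 1) = h x + 1) (hodd : ∀ x, h (-x) = -h x) (hs : ∀ x, h (F x) = h x + r)
    {x y z : ℝ} (hx : h x = z) (hy : h y = z)
    (hz : ∀ (n : ℕ) (m : ℤ), 2 * (z + n * r) + r ≠ m) (n : ℕ) :
    F^[n] y - F^[n] x = L ^ (∑ i ∈ Finset.range n,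
      (1 - 2 * (⌊z + r / 2 + i * r⌋ - ⌊z + r / 2 + i * r - 1 / 2⌋))) * (y - x) := by
  induction n with
  | zero => simp
  | succ n ih =>
    rw [Function.iterate_succ_apply', Function.iterate_succ_apply',
      hF.map_sub_map_of_semiconj_eq hm h1 hodd hs (z := z + n * r)
        (by rw [semiconj_iterate hs, hx]) (by rw [semiconj_iterate hs, hy]) (hz n), ih,
      Finset.sum_range_succ, add_comm (Finset.sum _ _), zpow_add₀ hF.pos.ne',
      add_right_comm z (r / 2)]
    ring

/-- The lengths of the iterates of an interval on which the semiconjugacy is constant are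
eventually small. -/
lemma finite_le_iterate_sub_iterate (hr : Irrational r)
    (hm : Monotone h) (h1 : ∀ x, h (x + 1) = h x + 1) (hodd : ∀ x, h (-x) = -h x)
    (hs : ∀ x, h (F x) = h x + r) {x y : ℝ} (hxy : h x = h y) {ε : ℝ} (hε : 0 < ε) :
    {n : ℕ | ε ≤ F^[n] y - F^[n] x}.Finite := by
  have h0 : h 0 = 0 := by
    have := hodd 0
    rw [neg_zero] at this
    linarith
  have hone : h 1 = 1 := by simpa [h0] using h1 0
  have hlt : ∀ {u v}, h u < h v → u < v := fun huv => hm.reflect_lt huv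
  set J : ℕ → Set ℝ := fun n =>
    Ioo (F^[n] x - ⌊h x + n * r⌋) (F^[n] y - ⌊h x + n * r⌋) with hJ
  have hJh : ∀ n, ∀ w ∈ J n, h w = Int.fract (h x + n * r) := by
    intro n w hw
    have e1 : F^[n] x ≤ w + ⌊h x + n * r⌋ := by linarith [hw.1]
    have e2 : w + ⌊h x + n * r⌋ ≤ F^[n] y := by linarith [hw.2]
    have e1 := hm e1
    have e2 := hm e2
    rw [semiconj_add_int h1, semiconj_iterate hs] at e1 e2
    rw [← hxy] at e2
    rw [Int.fract]
    linarith
  have hdisj : Pairwise (Function.onFun Disjoint J) := by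
    intro n n' hnn'
    refine Set.disjoint_left.2 fun w hw hw' => hnn' ?_
    have he := (hJh n w hw).symm.trans (hJh n' w hw')
    obtain ⟨m, hm'⟩ := Int.fract_eq_fract.1 he
    by_contra hne
    have hne' : ((n : ℤ) - n' : ℤ) ≠ 0 := by omega
    refine (hr.intCast_mul hne').ne_int m ?_
    push_cast
    linarith
  have hsub : (⋃ n, J n) ⊆ Ioo (-1) 1 := by
    refine Set.iUnion_subset fun n w hw => ?_
    have e := hJh n w hw
    have e1 := Int.fract_nonneg (h x + n * r)
    have e2 := Int.fract_lt_one (h x + n * r)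
    refine ⟨hlt ?_, hlt ?_⟩
    · rw [hodd, hone]; linarith
    · rw [hone]; linarith
  have hfin := MeasureTheory.Measure.finite_const_le_meas_of_disjoint_iUnion MeasureTheory.volume
    (ENNReal.ofReal_pos.2 hε) (fun n => measurableSet_Ioo) hdisj
    (((MeasureTheory.measure_mono hsub).trans_lt (by simp)).ne)
  refine hfin.subset fun n hn => ?_
  have hn : ε ≤ F^[n] y - F^[n] x := hn
  change ENNReal.ofReal ε ≤ MeasureTheory.volume (J n)
  rw [Real.volume_Ioo]
  exact ENNReal.ofReal_le_ofReal (by linarith)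

/-- The semiconjugacy to an irrational rotation is injective. -/
lemma strictMono_semiconj (hF : IsTwoSlopeLift F a b L) (hr : Irrational r)
    (hm : Monotone h) (h1 : ∀ x, h (x + 1) = h x + 1) (hodd : ∀ x, h (-x) = -h x)
    (hs : ∀ x, h (F x) = h x + r) : StrictMono h := by
  have hgood : ∀ z : ℝ, ∃ N : ℕ, ∀ n ≥ N, ∀ m : ℤ, 2 * (z + n * r) + r ≠ m := by
    intro z
    by_cases hex : ∃ (n : ℕ) (m : ℤ), 2 * (z + n * r) + r = m
    · obtain ⟨n₀, m₀, h₀⟩ := hex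
      refine ⟨n₀ + 1, fun n hn m hnm => ?_⟩
      have hne : (2 * ((n : ℤ) - n₀) : ℤ) ≠ 0 := by omega
      refine (hr.intCast_mul hne).ne_int (m - m₀) ?_
      push_cast
      linarith
    · push Not at hex
      exact ⟨0, fun n _ m => hex n m⟩
  refine hm.strictMono_of_injective fun x y hxy => ?_
  by_contra hne
  wlog hlt : x < y generalizing x y
  · exact this y x hxy.symm (Ne.symm hne) (lt_of_le_of_ne (not_lt.1 hlt) (Ne.symm hne))
  obtain ⟨N, hN⟩ := hgood (h x)
  set x' := F^[N] x with hx'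
  set y' := F^[N] y with hy'
  have hlt' : x' < y' := hF.strictMono.iterate N hlt
  have hxy' : h x' = h y' := by rw [hx', hy', semiconj_iterate hs, semiconj_iterate hs, hxy]
  have hz : ∀ (n : ℕ) (m : ℤ), 2 * (h x' + n * r) + r ≠ m := by
    intro n m
    have := hN (N + n) (by omega) m
    rw [hx', semiconj_iterate hs]
    push_cast at this
    rwa [add_mul, ← add_assoc] at this
  have hfin := finite_le_iterate_sub_iterate hr hm h1 hodd hs hxy'
    (ε := L ^ (-5 : ℤ) * (y' - x')) (mul_pos (zpow_pos hF.pos _) (sub_pos.2 hlt'))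
  obtain ⟨M, hM⟩ := hfin.bddAbove
  obtain ⟨n, hn, hn'⟩ := exists_le_sum_floor hr (h x' + r / 2) (M + 1)
  have hle : n ≤ M := hM <| by
    change L ^ (-5 : ℤ) * (y' - x') ≤ F^[n] y' - F^[n] x'
    rw [hF.iterate_sub_iterate_of_semiconj_eq hm h1 hodd hs rfl hxy'.symm hz]
    exact mul_le_mul_of_nonneg_right (zpow_le_zpow_right₀ hF.one_lt.le hn') (sub_pos.2 hlt').le
  omega

lemma continuous_semiconj (hF : IsTwoSlopeLift F a b L) (hr : Irrational r) (hm : Monotone h)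
    (h1 : ∀ x, h (x + 1) = h x + 1) (hodd : ∀ x, h (-x) = -h x) (hs : ∀ x, h (F x) = h x + r) : Continuous h := by
  refine hm.continuous_of_denseRange ?_
  have hdense := dense_addSubgroupClosure_pair_iff.2 (show Irrational (r / 1) by rwa [div_one])
  refine hdense.mono fun t ht => ?_
  obtain ⟨m, n, rfl⟩ := AddSubgroup.mem_closure_pair.1 ht
  obtain ⟨x, hx⟩ : ∃ x, h x = m * r := by
    induction m using Int.induction_on with
    | zero =>
      have h0 := hodd 0
      rw [neg_zero] at h0
      exact ⟨0, by push_cast; linarith⟩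
    | succ m ih =>
      obtain ⟨x, hx⟩ := ih (AddSubgroup.mem_closure_pair.2 ⟨_, _, rfl⟩)
      refine ⟨F x, ?_⟩
      rw [hs, hx]
      push_cast
      ring
    | pred m ih =>
      obtain ⟨x, hx⟩ := ih (AddSubgroup.mem_closure_pair.2 ⟨_, _, rfl⟩)
      obtain ⟨y, rfl⟩ := hF.surjective x
      refine ⟨y, ?_⟩
      rw [hs] at hx
      push_cast at hx ⊢
      linarith
  exact ⟨x + n, by rw [semiconj_add_int h1, hx]; simp⟩

end Irrational

end IsTwoSlopeLift

/-- Two lifts, one of which is pointwise larger, have different rotation numbers if one of them is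
conjugate to a translation. -/
lemma CircleDeg1Lift.translationNumber_ne_of_conj_translate (f : CircleDeg1Lift)
    (hf : Continuous f) {G H : ℝ → ℝ} {r : ℝ} (hHc : Continuous H) (hHm : StrictMono H)
    (hH1 : ∀ x, H (x + 1) = H x + 1) (hHG : ∀ x, H (G x) = H x + r)
    (hlt : (∀ x, f x < G x) ∨ ∀ x, G x < f x) : f.translationNumber ≠ r := by
  set H' : CircleDeg1Lift := ⟨⟨H, hHm.monotone⟩, hH1⟩ with hH'
  have hcH : ⇑H' = H := rfl
  have hsurj : Function.Surjective H' := H'.continuous_iff_surjective.1 hHc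
  obtain ⟨u, hu⟩ := CircleDeg1Lift.isUnit_iff_bijective.2
    (⟨hHm.injective, hsurj⟩ : Function.Bijective H')
  have huH : ∀ x, u x = H x := fun x => by rw [hu, hcH]
  have huc : Continuous ((u⁻¹ : CircleDeg1Liftˣ) : CircleDeg1Lift) :=
    (CircleDeg1Lift.continuous_iff_surjective _).2
      (CircleDeg1Lift.isUnit_iff_bijective.1 (Units.isUnit _)).2
  rw [← CircleDeg1Lift.translationNumber_conj_eq u f]
  set K : CircleDeg1Lift := u * f * (u⁻¹ : CircleDeg1Liftˣ) with hK
  have hKx : ∀ x, K x = H (f ((u⁻¹ : CircleDeg1Liftˣ) x)) := fun x => by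
    rw [hK, CircleDeg1Lift.mul_apply, CircleDeg1Lift.mul_apply, huH]
  have hKc : Continuous K := by
    have : ⇑K = fun x => H (f ((u⁻¹ : CircleDeg1Liftˣ) x)) := funext hKx
    rw [this]
    exact hHc.comp (hf.comp huc)
  have hHu : ∀ x, H ((u⁻¹ : CircleDeg1Liftˣ) x) = x := fun x => by
    rw [← huH, CircleDeg1Lift.units_apply_inv_apply]
  rcases hlt with hlt | hlt
  · refine (K.translationNumber_lt_of_forall_lt_add hKc fun x => ?_).ne
    have := hHm (hlt ((u⁻¹ : CircleDeg1Liftˣ) x))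
    rwa [hHG, hHu, ← hKx] at this
  · refine (K.lt_translationNumber_of_forall_add_lt hKc fun x => ?_).ne'
    have := hHm (hlt ((u⁻¹ : CircleDeg1Liftˣ) x))
    rwa [hHG, hHu, ← hKx] at this

/-- Reversible two-slope lifts whose rotation number is irrational or rational with even
denominator are conjugate to translations. -/
lemma IsTwoSlopeLift.exists_conj {F : ℝ → ℝ} {a b L r : ℝ} (hF : IsTwoSlopeLift F a b L)
    (hrot : rotationNumber F = r)
    (hcase : Irrational r ∨
      ∃ (p : ℤ) (q : ℕ), 0 < q ∧ Even q ∧ Int.gcd p (q : ℤ) = 1 ∧ r = (p : ℝ) / (q : ℝ)) :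
    ∃ H : ℝ → ℝ, Continuous H ∧ StrictMono H ∧ (∀ x : ℝ, H (x + 1) = H x + 1) ∧
      (∀ x : ℝ, H (F x) = H x + r) := by
  rw [hF.rotationNumber_eq] at hrot
  rcases hcase with hr | ⟨p, q, hq, ⟨k, hk⟩, hpq, hr⟩
  · obtain ⟨h, hm, h1, hodd, hs⟩ := hF.exists_odd_semiconj
    rw [hrot] at hs
    exact ⟨h, hF.continuous_semiconj hr hm h1 hodd hs, hF.strictMono_semiconj hr hm h1 hodd hs,
      h1, hs⟩
  · rw [← two_mul] at hk
    obtain ⟨j, rfl⟩ : Odd p := by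
      rw [← Int.not_even_iff_odd]
      intro hp
      have : (2 : ℤ) ∣ Int.gcd p q := Int.dvd_coe_gcd hp.two_dvd ⟨k, by rw [hk]; push_cast; ring⟩
      rw [hpq] at this
      omega
    obtain ⟨x₀, hx₀⟩ := (hF.toCircleDeg1Lift.translationNumber_eq_rat_iff
      (by exact hF.continuous) hq).1 (hrot.trans hr)
    rw [CircleDeg1Lift.coe_pow, hF.coe_toCircleDeg1Lift] at hx₀
    subst hk
    rw [hr]
    exact hF.exists_conj_of_iterate_eq_add hq (hF.iterate_eq_add hx₀)

lemma isTwoSlopeLift_Ftrap {ℓ α θ : ℝ} (hℓ : 0 < ℓ) (hα : 0 < α) (hα2 : α < π / 2)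
    (hθ : θ ∈ Set.Ioo (Real.arctan (2 * ℓ + Real.tan α)) (π / 2)) :
    IsTwoSlopeLift (Ftrap ℓ α θ) (brk1 ℓ α θ) (brk0 ℓ θ) (Lam α θ) := by
  have hT : 0 < tan α := tan_pos_of_pos_of_lt_pi_div_two hα hα2
  have ht : 2 * ℓ + tan α < tan θ := by
    have := tan_lt_tan_of_lt_of_lt_pi_div_two (neg_pi_div_two_lt_arctan _) hθ.2 hθ.1
    rwa [tan_arctan] at this
  have hθ0 : 0 < θ := (arctan_pos.2 (by positivity)).trans hθ.1
  have hcα : 0 < cos α := cos_pos_of_mem_Ioo ⟨by linarith, hα2⟩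
  have hcθ : 0 < cos θ := cos_pos_of_mem_Ioo ⟨by linarith, hθ.2⟩
  have ht0 : 0 < tan θ := by linarith
  have hd : 0 < tan θ - tan α := by linarith
  have hL : Lam α θ = (tan θ + tan α) / (tan θ - tan α) := by
    have e1 : sin (θ + α) = cos θ * cos α * (tan θ + tan α) := by
      rw [sin_add, tan_eq_sin_div_cos, tan_eq_sin_div_cos]; field_simp
    have e2 : sin (θ - α) = cos θ * cos α * (tan θ - tan α) := by
      rw [sin_sub, tan_eq_sin_div_cos, tan_eq_sin_div_cos]; field_simp
    rw [Lam, e1, e2, mul_div_mul_left _ _ (by positivity)]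
  have hL1 : 1 < Lam α θ := by
    rw [hL, lt_div_iff₀ hd]; linarith
  have hab : brk1 ℓ α θ < brk0 ℓ θ := by
    rw [brk1, brk0, div_lt_div_iff_of_pos_right (by positivity)]; linarith
  have hsl : Lam α θ * (brk1 ℓ α θ + 1 - brk0 ℓ θ) = brk0 ℓ θ - brk1 ℓ α θ := by
    rw [hL, brk1, brk0]
    field_simp
    ring
  have hbd : 0 < brk1 ℓ α θ + 1 - brk0 ℓ θ := by
    by_contra! h
    nlinarith
  have hadd : ∀ x, Ftrap ℓ α θ (x + 1) = Ftrap ℓ α θ x + 1 := by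
    intro x
    have : ⌊x + 1 - brk1 ℓ α θ⌋ = ⌊x - brk1 ℓ α θ⌋ + 1 := by
      rw [← Int.floor_add_one]; congr 1; ring
    rw [Ftrap, Ftrap, this]
    push_cast
    rw [add_sub_add_right_eq_sub, add_assoc]
  have heq : ∀ x, brk1 ℓ α θ ≤ x → x < brk1 ℓ α θ + 1 → Ftrap ℓ α θ x = Ftrap0 ℓ α θ x := by
    intro x h1 h2
    have : ⌊x - brk1 ℓ α θ⌋ = 0 := by
      rw [Int.floor_eq_zero_iff]; constructor <;> linarith
    simp [Ftrap, this]
  have hleft : ∀ x, brk1 ℓ α θ ≤ x → x ≤ brk0 ℓ θ →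
      Ftrap ℓ α θ x = -brk1 ℓ α θ + (Lam α θ)⁻¹ * (x - brk1 ℓ α θ) := by
    intro x h1 h2
    rw [heq x h1 (by linarith), Ftrap0, if_pos h2]
  refine ⟨hL1, hab, hsl, hadd, hleft, fun x h1 h2 => ?_⟩
  rcases h2.eq_or_lt with rfl | h2
  · rw [hadd, hleft _ le_rfl hab.le]
    linear_combination -hsl
  · rcases h1.eq_or_lt with rfl | h1
    · rw [hleft _ hab.le le_rfl, ← hsl, inv_mul_cancel_left₀ (by positivity)]
      ring
    · rw [heq x (by linarith) h2, Ftrap0, if_neg h1.not_ge]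

lemma Ftrap_lt_Ftrap {ℓ α θ θ' : ℝ} (hℓ : 0 < ℓ) (hα : 0 < α) (hα2 : α < π / 2)
    (hθ : θ ∈ Set.Ioo (Real.arctan (2 * ℓ + Real.tan α)) (π / 2))
    (hθ' : θ' ∈ Set.Ioo (Real.arctan (2 * ℓ + Real.tan α)) (π / 2)) (hlt : θ < θ') (x : ℝ) :
    Ftrap ℓ α θ' x < Ftrap ℓ α θ x := by
  have hT : 0 < tan α := tan_pos_of_pos_of_lt_pi_div_two hα hα2
  have ht : 2 * ℓ + tan α < tan θ := by
    have := tan_lt_tan_of_lt_of_lt_pi_div_two (neg_pi_div_two_lt_arctan _) hθ.2 hθ.1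
    rwa [tan_arctan] at this
  have htt : tan θ < tan θ' := tan_lt_tan_of_lt_of_lt_pi_div_two
    ((neg_pi_div_two_lt_arctan _).trans hθ.1) hθ'.2 hlt
  have ht0 : 0 < tan θ := by linarith
  have ht0' : 0 < tan θ' := by linarith
  have hb : ∀ t, brk0 ℓ t = (tan t - 2 * ℓ) / (2 * tan t) := fun _ => rfl
  have ha : ∀ t, brk1 ℓ α t = -(2 * ℓ + tan α) / (2 * tan t) := fun _ => rfl
  refine (isTwoSlopeLift_Ftrap hℓ hα hα2 hθ').lt_of_lt (isTwoSlopeLift_Ftrap hℓ hα hα2 hθ)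
    ?_ ?_ ?_ ?_ x
  · rw [ha, ha, div_lt_div_iff₀ (by positivity) (by positivity)]
    nlinarith
  · rw [hb, hb, div_lt_div_iff₀ (by positivity) (by positivity)]
    nlinarith
  · have h1 : brk1 ℓ α θ' < 0 := div_neg_of_neg_of_pos (by linarith) (by positivity)
    have h2 : 0 < brk0 ℓ θ := div_pos (by linarith) (by positivity)
    exact h1.trans h2
  · have h1 : brk0 ℓ θ' < 1 / 2 := by
      rw [hb, div_lt_iff₀ (by positivity)]; linarith
    have h2 : -(1 / 2) < brk1 ℓ α θ := by
      rw [ha, lt_div_iff₀ (by positivity)]; linarith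
    linarith

/-- if r ∈ [0,1) is irrational or rational with even denominator
(in lowest terms), and θ* realizes r as a rotation number, then θ* is the
unique such parameter and the circle map at θ* is topologically conjugate
to the rotation by r. -/
theorem stmt9 (ℓ α : ℝ) (hℓ : 0 < ℓ) (hα : 0 < α) (hα2 : α < π / 2)
    (r : ℝ) (hr : r ∈ Set.Ico (0 : ℝ) 1)
    (hcase : Irrational r ∨
      ∃ (p : ℤ) (q : ℕ), 0 < q ∧ Even q ∧ Int.gcd p (q : ℤ) = 1 ∧
        r = (p : ℝ) / (q : ℝ))
    (θstar : ℝ)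
    (hθstar : θstar ∈ Set.Ioo (Real.arctan (2 * ℓ + Real.tan α)) (π / 2))
    (hrot : rotationNumber (Ftrap ℓ α θstar) = r) :
    (∀ θ ∈ Set.Ioo (Real.arctan (2 * ℓ + Real.tan α)) (π / 2),
      rotationNumber (Ftrap ℓ α θ) = r → θ = θstar) ∧
    ∃ H : ℝ → ℝ, Continuous H ∧ StrictMono H ∧
      (∀ x : ℝ, H (x + 1) = H x + 1) ∧
      (∀ x : ℝ, H (Ftrap ℓ α θstar x) = H x + r) := by
  have hF := isTwoSlopeLift_Ftrap hℓ hα hα2 hθstar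
  obtain ⟨H, hHc, hHm, hH1, hHF⟩ := hF.exists_conj hrot hcase
  refine ⟨fun θ hθ hθr => ?_, H, hHc, hHm, hH1, hHF⟩
  by_contra hne
  have hF' := isTwoSlopeLift_Ftrap hℓ hα hα2 hθ
  refine hF'.toCircleDeg1Lift.translationNumber_ne_of_conj_translate
    (by exact hF'.continuous) hHc hHm hH1 hHF ?_ (hF'.rotationNumber_eq ▸ hθr)
  rcases lt_or_gt_of_ne hne with hlt | hlt
  · exact Or.inr (Ftrap_lt_Ftrap hℓ hα hα2 hθ hθstar hlt)
  · exact Or.inl (Ftrap_lt_Ftrap hℓ hα hα2 hθstar hθ hlt)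
end
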